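/- arXiv:math/0505310 — 2 statements merged into one kernel-verified Lean document; each statement's English description precedes it below -/
import Mathlib

section
/- For every integer N ≥ 2, every ℏ > 0 and every λ = (λ_1,…,λ_N) ∈ ℝ^N, the Givental integral Ψ^{(N)}_λ is a smooth function of x ∈ ℝ^N and is an eigenfunction of the quadratic open Toda chain Hamiltonian: −(ℏ²/2) Σ_{i=1}^{N} ∂²Ψ^{(N)}_λ/∂x_i² + ( Σ_{i=1}^{N−1} e^{x_i − x_{i+1}} ) Ψ^{(N)}_λ = ( (1/2) Σ_{k=1}^{N} λ_k² ) Ψ^{(N)}_λ. -/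
open MeasureTheory

noncomputable section

/-- The index set of the Givental variables `T_{k,i}`, `1 ≤ i ≤ k ≤ N−1`: the pair
`(p₁, p₂) : Fin N × Fin N` encodes `(k, i) = (p₁+1, p₂+1)`. It has `N(N−1)/2` elements. -/
abbrev GIdx (N : ℕ) : Type :=
  {p : Fin N × Fin N // p.2.val ≤ p.1.val ∧ p.1.val + 1 ≤ N - 1}

/-- The value `T_{k,i}` (1-based indices) of a point `T : GIdx N → ℝ` of the Givental
integration domain, with the boundary convention `T_{N,i} := x_i`; the value is `0` for
out-of-range indices. -/
def gval (N : ℕ) (x : Fin N → ℝ) (T : GIdx N → ℝ) (k i : ℕ) : ℝ :=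
  if h : 1 ≤ i ∧ i ≤ k ∧ k ≤ N - 1 then
    T ⟨(⟨k - 1, by omega⟩, ⟨i - 1, by omega⟩),
       ⟨by show i - 1 ≤ k - 1; omega, by show k - 1 + 1 ≤ N - 1; omega⟩⟩
  else if h' : k = N ∧ 1 ≤ i ∧ i ≤ N then x ⟨i - 1, by omega⟩
  else 0

/-- The Givental potential
`𝓕_N(T; λ, x) = i Σ_{k=1}^{N} λ_k (Σ_{i=1}^{k} T_{k,i} − Σ_{i=1}^{k−1} T_{k−1,i})
 − Σ_{k=1}^{N−1} Σ_{i=1}^{k} (e^{T_{k+1,i} − T_{k,i}} + e^{T_{k,i} − T_{k+1,i+1}})`,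
with `T_{N,i} := x_i`. -/
def Fpot (N : ℕ) (lam x : Fin N → ℝ) (T : GIdx N → ℝ) : ℂ :=
  Complex.I * ∑ a : Fin N, (lam a : ℂ) *
      ((∑ i ∈ Finset.Icc 1 (a.val + 1), (gval N x T (a.val + 1) i : ℂ))
        - ∑ i ∈ Finset.Icc 1 a.val, (gval N x T a.val i : ℂ))
    - ∑ k ∈ Finset.Icc 1 (N - 1), ∑ i ∈ Finset.Icc 1 k,
        ((Real.exp (gval N x T (k + 1) i - gval N x T k i) : ℂ)
          + (Real.exp (gval N x T k i - gval N x T (k + 1) (i + 1)) : ℂ))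

/-- The Givental integrand `T ↦ exp( 𝓕_N(T; λ, x) / ℏ )`. -/
def givIntegrand (N : ℕ) (hbar : ℝ) (lam x : Fin N → ℝ) (T : GIdx N → ℝ) : ℂ :=
  Complex.exp (Fpot N lam x T / (hbar : ℂ))

/-- The Givental integral `Ψ^{(N)}_λ(x) = ∫ exp( 𝓕_N(T; λ, x) / ℏ ) dT` over
`ℝ^{N(N−1)/2}`. -/
def GivPsi (N : ℕ) (hbar : ℝ) (lam : Fin N → ℝ) (x : Fin N → ℝ) : ℂ :=
  ∫ T : GIdx N → ℝ, givIntegrand N hbar lam x T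

section FiberDominated

variable {X V : Type*} [NormedAddCommGroup X] [MeasurableSpace V]

/-- A function on `X × V` is fibrewise dominated if on every bounded set of parameters `x : X` it
is bounded by a fixed integrable function of `T : V`. -/
def FiberDominated {E : Type*} [Norm E] (μ : Measure V) (f : X × V → E) :
    Prop :=
  ∀ R : ℝ, ∃ g : V → ℝ, Integrable g μ ∧ ∀ x T, ‖x‖ ≤ R → ‖f (x, T)‖ ≤ g T

variable {μ : Measure V}

lemma FiberDominated.add {E : Type*} [NormedAddCommGroup E] {f g : X × V → E}
    (hf : FiberDominated μ f) (hg : FiberDominated μ g) :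
    FiberDominated μ (fun z => f z + g z) := fun R => by
  obtain ⟨a, ha, ha'⟩ := hf R
  obtain ⟨b, hb, hb'⟩ := hg R
  exact ⟨a + b, ha.add hb,
    fun x T hx => (norm_add_le _ _).trans (add_le_add (ha' x T hx) (hb' x T hx))⟩

lemma fiberDominated_zero {E : Type*} [NormedAddCommGroup E] :
    FiberDominated μ (fun _ : X × V => (0 : E)) :=
  fun _ => ⟨0, integrable_zero _ _ _, fun _ _ _ => by simp⟩

lemma FiberDominated.const_smul {E : Type*} [NormedAddCommGroup E] [NormedSpace ℂ E]
    {f : X × V → E} (hf : FiberDominated μ f) (a : ℂ) :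
    FiberDominated μ (fun z => a • f z) := fun R => by
  obtain ⟨b, hb, hb'⟩ := hf R
  exact ⟨fun T => ‖a‖ * b T, hb.const_mul _, fun x T hx => by
    rw [norm_smul]
    exact mul_le_mul_of_nonneg_left (hb' x T hx) (norm_nonneg _)⟩

lemma FiberDominated.smul_const {E : Type*} [NormedAddCommGroup E] [NormedSpace ℂ E]
    {f : X × V → ℂ} (hf : FiberDominated μ f) (a : E) :
    FiberDominated μ (fun z => f z • a) := fun R => by
  obtain ⟨b, hb, hb'⟩ := hf R
  exact ⟨fun T => b T * ‖a‖, hb.mul_const _, fun x T hx => by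
    rw [norm_smul]
    exact mul_le_mul_of_nonneg_right (hb' x T hx) (norm_nonneg _)⟩

lemma FiberDominated.sum {E ι : Type*} [NormedAddCommGroup E] (s : Finset ι)
    {f : ι → X × V → E} (hf : ∀ i ∈ s, FiberDominated μ (f i)) :
    FiberDominated μ (fun z => ∑ i ∈ s, f i z) := by
  classical
  induction s using Finset.induction_on with
  | empty => simpa using fiberDominated_zero
  | insert i s hi ih =>
    simp only [Finset.sum_insert hi]
    exact (hf i (by simp)).add (ih fun k hk => hf k (by simp [hk]))

end FiberDominated

lemma FiberDominated.integrable {X V E : Type*} [NormedAddCommGroup X]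
    [TopologicalSpace V] [SecondCountableTopology V] [MeasurableSpace V] [BorelSpace V]
    {μ : Measure V}
    [NormedAddCommGroup E] {f : X × V → E} (hf : FiberDominated μ f) (hc : Continuous f) (x : X) :
    Integrable (fun T => f (x, T)) μ := by
  obtain ⟨b, hb, hb'⟩ := hf ‖x‖
  exact hb.mono' (Continuous.aestronglyMeasurable (by fun_prop))
    (ae_of_all _ fun T => hb' x T le_rfl)

section ExpIntegral

variable {X V J : Type*} [NormedAddCommGroup X] [NormedSpace ℝ X]
  [NormedAddCommGroup V] [NormedSpace ℝ V] [Fintype J]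

/-- The exponential `exp (∑ mⱼ ℓⱼ - c ∑ exp ℓⱼ + i p)`. -/
def expWave (l : J → X × V →L[ℝ] ℝ) (p : X × V →L[ℝ] ℝ) (c : ℝ) (m : J → ℕ) (z : X × V) : ℂ :=
  Complex.exp ((∑ j, (m j * l j z - c * Real.exp (l j z)) : ℝ) + Complex.I * (p z : ℝ))

/-- The linear span of the exponentials `expWave l p c m`, `m : J → ℕ`. -/
def expSpan (l : J → X × V →L[ℝ] ℝ) (p : X × V →L[ℝ] ℝ) (c : ℝ) : Submodule ℂ (X × V → ℂ) :=
  Submodule.span ℂ (Set.range (expWave l p c))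

variable {l : J → X × V →L[ℝ] ℝ} {p : X × V →L[ℝ] ℝ} {c : ℝ}

lemma norm_expWave (m : J → ℕ) (z : X × V) :
    ‖expWave l p c m z‖ = Real.exp (∑ j, (m j * l j z - c * Real.exp (l j z))) := by
  rw [expWave, Complex.norm_exp, Complex.add_re, Complex.ofReal_re]
  simp

lemma expWave_mem_expSpan (m : J → ℕ) : expWave l p c m ∈ expSpan l p c :=
  Submodule.subset_span ⟨m, rfl⟩

lemma exp_mul_expWave [DecidableEq J] (m : J → ℕ) (j : J) (z : X × V) :
    (Real.exp (l j z) : ℂ) * expWave l p c m z = expWave l p c (m + Pi.single j 1) z := by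
  rw [expWave, expWave, Complex.ofReal_exp, ← Complex.exp_add]
  congr 1
  have : ∑ k, ((((m + Pi.single j 1 : J → ℕ) k : ℕ) : ℝ) * l k z - c * Real.exp (l k z))
      = l j z + ∑ k, (m k * l k z - c * Real.exp (l k z)) := by
    simp only [Pi.add_apply, Nat.cast_add, add_mul, Finset.sum_sub_distrib, Finset.sum_add_distrib]
    simp [Pi.single_apply]
    ring
  rw [this]
  push_cast
  ring

lemma contDiff_expWave (m : J → ℕ) : ContDiff ℝ (⊤ : ℕ∞) (expWave l p c m) := by
  unfold expWave
  refine Complex.contDiff_exp.comp (ContDiff.add ?_ (contDiff_const.mul ?_))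
  · refine Complex.ofRealCLM.contDiff.comp (ContDiff.sum fun j _ => ?_)
    fun_prop
  · exact Complex.ofRealCLM.contDiff.comp p.contDiff

lemma hasFDerivAt_expWave [DecidableEq J] (m : J → ℕ) (z : X × V) :
    HasFDerivAt (expWave l p c m)
      (∑ j, ((m j : ℂ) * expWave l p c m z - c * expWave l p c (m + Pi.single j 1) z) •
          Complex.ofRealCLM.comp (l j)
        + (Complex.I * expWave l p c m z) • Complex.ofRealCLM.comp p) z := by
  have h1 : HasFDerivAt (fun z => ∑ j, (m j * l j z - c * Real.exp (l j z)))
      (∑ j, ((m j : ℝ) • l j - c • (Real.exp (l j z) • l j))) z := by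
    refine HasFDerivAt.fun_sum fun j _ => ?_
    exact ((l j).hasFDerivAt.const_mul _).sub (((l j).hasFDerivAt.exp).const_mul _)
  have h2 := ((Complex.ofRealCLM.hasFDerivAt.comp z h1).add
    ((Complex.ofRealCLM.hasFDerivAt.comp z p.hasFDerivAt).const_mul Complex.I)).cexp
  refine h2.congr_fderiv ?_
  ext w <;>
  · simp only [← exp_mul_expWave]
    simp [expWave, -Finset.sum_sub_distrib]
    rw [Finset.mul_sum]
    congr 1
    · refine Finset.sum_congr rfl fun j _ => ?_
      ring
    · ring

lemma exists_mul_le_add_mul_exp {c : ℝ} (hc : 0 < c) (m : ℕ) :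
    ∃ C : ℝ, ∀ t : ℝ, m * t ≤ C + c * Real.exp t := by
  rcases Nat.eq_zero_or_pos m with rfl | hm
  · exact ⟨0, fun t => by simp; positivity⟩
  have hm' : (0 : ℝ) < m := by exact_mod_cast hm
  refine ⟨-(m * (Real.log (c / m) + 1)), fun t => ?_⟩
  have h := Real.add_one_le_exp (t + Real.log (c / m))
  rw [Real.exp_add, Real.exp_log (by positivity)] at h
  have := mul_le_mul_of_nonneg_left h hm'.le
  have e : (m : ℝ) * (Real.exp t * (c / m)) = c * Real.exp t := by field_simp
  linarith

lemma integrable_exp_neg_mul_norm [FiniteDimensional ℝ V] [MeasurableSpace V] [BorelSpace V]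
    (μ : Measure V) [μ.IsAddHaarMeasure] {δ : ℝ} (hδ : 0 < δ) :
    Integrable (fun T : V => Real.exp (-(δ * ‖T‖))) μ := by
  set n := Module.finrank ℝ V + 1
  have hn : (Module.finrank ℝ V : ℝ) < (n : ℝ) := by simp [n]
  refine ((integrable_one_add_norm (μ := μ) hn).const_mul
    (Real.exp δ * n.factorial / δ ^ n)).mono' (by fun_prop) (ae_of_all _ fun T => ?_)
  have h := Real.pow_div_factorial_le_exp (δ * (1 + ‖T‖)) (by positivity) n
  rw [Real.rpow_neg (by positivity), Real.rpow_natCast, Real.norm_eq_abs, Real.abs_exp,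
    Real.exp_neg, ← one_div, ← div_eq_mul_inv, div_div, div_le_div_iff₀ (by positivity)
    (by positivity)]
  rw [div_le_iff₀ (by positivity), mul_pow, mul_add, mul_one, Real.exp_add] at h
  linarith

variable [MeasurableSpace V] {μ : Measure V}

/-- The linear forms `ℓⱼ` are coercive along `V`. -/
def ExpCoercive (l : J → X × V →L[ℝ] ℝ) : Prop :=
  ∃ K : ℝ, 0 < K ∧ ∀ T : V, ‖T‖ ≤ K * ∑ j, Real.exp (l j (0, T))

variable [BorelSpace V] [FiniteDimensional ℝ V] [μ.IsAddHaarMeasure]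

lemma fiberDominated_expWave (hl : ExpCoercive l) (hc : 0 < c) (m : J → ℕ) :
    FiberDominated μ (expWave l p c m) := fun R => by
  obtain ⟨K, hK, hl⟩ := hl
  choose C hC using fun j => exists_mul_le_add_mul_exp (half_pos hc) (m j)
  set c' := c / 2 * Real.exp (-(∑ j, ‖l j‖ * |R|))
  have hc' : 0 < c' := by positivity
  refine ⟨fun T => Real.exp (∑ j, C j) * Real.exp (-(c' / K * ‖T‖)),
    (integrable_exp_neg_mul_norm μ (by positivity)).const_mul _, fun x T hx => ?_⟩
  beta_reduce
  rw [norm_expWave, ← Real.exp_add, Real.exp_le_exp]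
  have h1 : ∀ j, m j * l j (x, T) - c * Real.exp (l j (x, T))
      ≤ C j - c' * Real.exp (l j (0, T)) := fun j => by
    have h2 : l j (0, T) - ∑ j, ‖l j‖ * |R| ≤ l j (x, T) := by
      have e : l j (x, T) = l j (x, 0) + l j (0, T) := by
        rw [← map_add]; simp
      have h3 : |l j (x, 0)| ≤ ‖l j‖ * |R| := by
        refine ((l j).le_opNorm (x, 0)).trans ?_
        gcongr
        simpa using hx.trans (le_abs_self R)
      have h4 : ‖l j‖ * |R| ≤ ∑ j, ‖l j‖ * |R| :=
        Finset.single_le_sum (f := fun j => ‖l j‖ * |R|) (fun _ _ => by positivity)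
          (Finset.mem_univ j)
      have := neg_abs_le (l j (x, 0))
      linarith
    have h5 := Real.exp_le_exp.mpr h2
    rw [sub_eq_add_neg, Real.exp_add] at h5
    have h6 := mul_le_mul_of_nonneg_left h5 (half_pos hc).le
    have h7 : c / 2 * (Real.exp (l j (0, T)) * Real.exp (-(∑ j, ‖l j‖ * |R|)))
        = c' * Real.exp (l j (0, T)) := by simp only [c']; ring
    have := hC j (l j (x, T))
    linarith
  refine (Finset.sum_le_sum fun j _ => h1 j).trans ?_
  rw [Finset.sum_sub_distrib, ← Finset.mul_sum]
  have h8 : c' / K * ‖T‖ ≤ c' * ∑ j, Real.exp (l j (0, T)) := by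
    rw [div_mul_eq_mul_div, div_le_iff₀ hK]
    have := mul_le_mul_of_nonneg_left (hl T) hc'.le
    linarith
  linarith

lemma expSpan_regular (hl : ExpCoercive l) (hc : 0 < c) {f : X × V → ℂ}
    (hf : f ∈ expSpan l p c) :
    ContDiff ℝ (⊤ : ℕ∞) f ∧ FiberDominated μ f ∧ FiberDominated μ (fderiv ℝ f) ∧
      ∀ w, (fun z => fderiv ℝ f z w) ∈ expSpan l p c := by
  classical
  induction hf using Submodule.span_induction with
  | mem f hf =>
    obtain ⟨m, rfl⟩ := hf
    have hd := fun m => fiberDominated_expWave (p := p) (μ := μ) hl hc m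
    have e : fderiv ℝ (expWave l p c m) = _ :=
      funext fun z => (hasFDerivAt_expWave (l := l) (p := p) (c := c) m z).fderiv
    refine ⟨contDiff_expWave m, hd m, ?_, fun w => ?_⟩
    · rw [e]
      refine FiberDominated.add (FiberDominated.sum _ fun j _ =>
          FiberDominated.smul_const (E := X × V →L[ℝ] ℂ) ?_ _)
        (FiberDominated.smul_const (E := X × V →L[ℝ] ℂ)
          (f := fun z => Complex.I * expWave l p c m z)
          ((hd m).const_smul Complex.I) _)
      simp only [sub_eq_add_neg, ← neg_mul]
      exact ((hd m).const_smul _).add ((hd _).const_smul _)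
    · have : (fun z => fderiv ℝ (expWave l p c m) z w)
          = ∑ j, (((m j : ℂ) * (l j w : ℂ)) • expWave l p c m
              - ((c : ℂ) * (l j w : ℂ)) • expWave l p c (m + Pi.single j 1))
            + (Complex.I * (p w : ℂ)) • expWave l p c m := by
        funext z
        rw [e]
        simp only [add_apply, sum_apply, Pi.add_apply,
          Finset.sum_apply, Pi.sub_apply, Pi.smul_apply, smul_apply,
          ContinuousLinearMap.comp_apply, Complex.ofRealCLM_apply, smul_eq_mul]
        congr 1
        · exact Finset.sum_congr rfl fun j _ => by ring
        · ring
      rw [this]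
      refine add_mem (sum_mem fun j _ => sub_mem ?_ ?_) ?_ <;>
        exact Submodule.smul_mem _ _ (expWave_mem_expSpan _)
  | zero =>
    refine ⟨contDiff_const, fiberDominated_zero, ?_, fun w => ?_⟩
    · have : fderiv ℝ (0 : X × V → ℂ) = fun _ => 0 := by ext1 z; simp
      rw [this]
      exact fiberDominated_zero
    · simp
      exact zero_mem _
  | add f g _ _ hf hg =>
    have e : fderiv ℝ (f + g) = fun z => fderiv ℝ f z + fderiv ℝ g z := funext fun z =>
      fderiv_add (hf.1.differentiable (by simp) z) (hg.1.differentiable (by simp) z)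
    rw [e]
    exact ⟨hf.1.add hg.1, hf.2.1.add hg.2.1, hf.2.2.1.add hg.2.2.1,
      fun w => add_mem (hf.2.2.2 w) (hg.2.2.2 w)⟩
  | smul a f _ hf =>
    have e : fderiv ℝ (a • f) = fun z => a • fderiv ℝ f z := funext fun z =>
      fderiv_const_smul (hf.1.differentiable (by simp) z) a
    rw [e]
    exact ⟨hf.1.const_smul a, hf.2.1.const_smul a, hf.2.2.1.const_smul a,
      fun w => Submodule.smul_mem _ a (hf.2.2.2 w)⟩

lemma integrable_of_mem_expSpan (hl : ExpCoercive l) (hc : 0 < c) {f : X × V → ℂ}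
    (hf : f ∈ expSpan l p c) (x : X) : Integrable (fun T => f (x, T)) μ := by
  obtain ⟨h1, h2, -⟩ := expSpan_regular (μ := μ) hl hc hf
  exact h2.integrable h1.continuous x

lemma hasFDerivAt_integral_of_mem_expSpan (hl : ExpCoercive l) (hc : 0 < c) {f : X × V → ℂ}
    (hf : f ∈ expSpan l p c) (x : X) :
    HasFDerivAt (fun x => ∫ T, f (x, T) ∂μ)
      (∫ T, (fderiv ℝ f (x, T)).comp (ContinuousLinearMap.inl ℝ X V) ∂μ) x := by
  obtain ⟨h1, h2, h3, h4⟩ := expSpan_regular (μ := μ) hl hc hf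
  obtain ⟨b, hb, hb'⟩ := h3 (‖x‖ + 1)
  have hcf : Continuous (fderiv ℝ f) := h1.continuous_fderiv (by simp)
  have hcf' : Continuous (fun z => (fderiv ℝ f z).comp (ContinuousLinearMap.inl ℝ X V)) :=
    hcf.clm_comp continuous_const
  refine hasFDerivAt_integral_of_dominated_of_fderiv_le (bound := b)
    (F' := fun x T => (fderiv ℝ f (x, T)).comp (ContinuousLinearMap.inl ℝ X V))
    (Metric.ball_mem_nhds x one_pos) (Filter.Eventually.of_forall fun y =>
      (h2.integrable h1.continuous y).aestronglyMeasurable) (h2.integrable h1.continuous x)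
      (hcf'.comp (by fun_prop : Continuous fun T : V => (x, T))).aestronglyMeasurable
      (ae_of_all _ fun T y hy => ?_) hb (ae_of_all _ fun T y hy => ?_)
  · have hy' : ‖y‖ ≤ ‖x‖ + 1 := by
      have := norm_le_norm_add_norm_sub' y x
      rw [Metric.mem_ball, dist_eq_norm] at hy
      linarith
    refine ((ContinuousLinearMap.opNorm_comp_le _ _).trans ?_).trans (hb' y T hy')
    exact mul_le_of_le_one_right (norm_nonneg _) (ContinuousLinearMap.norm_inl_le_one ℝ X V)
  · have := (h1.differentiable (by simp) (y, T)).hasFDerivAt.comp y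
      (hasFDerivAt_prodMk_left (𝕜 := ℝ) y T)
    exact this

lemma fderiv_integral_of_mem_expSpan (hl : ExpCoercive l) (hc : 0 < c) {f : X × V → ℂ}
    (hf : f ∈ expSpan l p c) (x v : X) :
    fderiv ℝ (fun x => ∫ T, f (x, T) ∂μ) x v = ∫ T, fderiv ℝ f (x, T) (v, 0) ∂μ := by
  obtain ⟨h1, h2, h3, h4⟩ := expSpan_regular (μ := μ) hl hc hf
  have hcf : Continuous (fderiv ℝ f) := h1.continuous_fderiv (by simp)
  rw [(hasFDerivAt_integral_of_mem_expSpan hl hc hf x).fderiv,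
    ContinuousLinearMap.integral_apply]
  · rfl
  · exact ((ContinuousLinearMap.compL ℝ X (X × V) ℂ).flip
      (ContinuousLinearMap.inl ℝ X V)).integrable_comp (h3.integrable hcf x)

lemma contDiff_integral_of_mem_expSpan [FiniteDimensional ℝ X] (hl : ExpCoercive l) (hc : 0 < c)
    {f : X × V → ℂ} (hf : f ∈ expSpan l p c) :
    ContDiff ℝ (⊤ : ℕ∞) (fun x => ∫ T, f (x, T) ∂μ) := by
  rw [contDiff_infty]
  intro n
  induction n generalizing f with
  | zero =>
    exact contDiff_zero.mpr (continuous_iff_continuousAt.mpr fun x =>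
      (hasFDerivAt_integral_of_mem_expSpan hl hc hf x).continuousAt)
  | succ n ih =>
    rw [Nat.cast_add, Nat.cast_one, contDiff_succ_iff_fderiv_apply]
    refine ⟨fun x => (hasFDerivAt_integral_of_mem_expSpan hl hc hf x).differentiableAt,
      by simp, fun v => ?_⟩
    simp_rw [fderiv_integral_of_mem_expSpan hl hc hf]
    exact ih ((expSpan_regular (μ := μ) hl hc hf).2.2.2 (v, 0))

lemma integral_fderiv_fiber_eq_zero (hl : ExpCoercive l) (hc : 0 < c) {f : X × V → ℂ}
    (hf : f ∈ expSpan l p c) (x : X) (u : V) : ∫ T, fderiv ℝ f (x, T) (0, u) ∂μ = 0 := by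
  obtain ⟨h1, h2, h3, h4⟩ := expSpan_regular (μ := μ) hl hc hf
  have hd : ∀ T, HasFDerivAt (fun T => f (x, T))
      ((fderiv ℝ f (x, T)).comp (ContinuousLinearMap.inr ℝ X V)) T := fun T =>
    (h1.differentiable (by simp) (x, T)).hasFDerivAt.comp T
      (hasFDerivAt_prodMk_right (𝕜 := ℝ) x T)
  have e : ∀ T, fderiv ℝ (fun T => f (x, T)) T u = fderiv ℝ f (x, T) (0, u) := fun T => by
    rw [(hd T).fderiv]; simp
  have hi : Integrable (fun T => fderiv ℝ f (x, T) (0, u)) μ :=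
    integrable_of_mem_expSpan hl hc (h4 (0, u)) x
  have := integral_smul_fderiv_eq_neg_fderiv_smul_of_integrable (μ := μ) (𝕜 := ℝ)
    (f := fun _ : V => (1 : ℝ)) (g := fun T => f (x, T)) (v := u) (by simp)
    (by simpa [e] using hi) (by simpa using h2.integrable h1.continuous x)
    (fun T _ => differentiableAt_const _) (fun T _ => (hd T).differentiableAt)
  simpa [e] using this

end ExpIntegral

section Givental

/-- The space of all variables `(x, T)`. -/
abbrev GSpace (M : ℕ) : Type := (Fin (M + 1) → ℝ) × (GIdx (M + 1) → ℝ)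

/-- The index set of the exponential terms of the Givental potential. -/
abbrev GTerm (M : ℕ) : Type := (Σ r : Fin M, Fin (r.val + 1)) × Bool

/-- The coordinate in row `r`, column `i` (both counted from zero) of the Givental triangle. -/
def gcoord (M r i : ℕ) : GSpace M →L[ℝ] ℝ :=
  if h : i ≤ r ∧ r < M then
    (ContinuousLinearMap.proj (R := ℝ) (φ := fun _ : GIdx (M + 1) => ℝ)
      ⟨(⟨r, by omega⟩, ⟨i, by omega⟩), ⟨h.1, by simpa using h.2⟩⟩).comp
        (ContinuousLinearMap.snd ℝ _ _)
  else if h' : r = M ∧ i ≤ M then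
    (ContinuousLinearMap.proj (R := ℝ) (φ := fun _ : Fin (M + 1) => ℝ) ⟨i, by omega⟩).comp
      (ContinuousLinearMap.fst ℝ _ _)
  else 0

/-- The vector dual to the coordinate `gcoord M r i`. -/
def gbasis (M r i : ℕ) : GSpace M :=
  (fun k => if r = M ∧ k.val = i then 1 else 0,
    fun q => if q.1.1.val = r ∧ q.1.2.val = i then 1 else 0)

/-- The exponents `T_{k+1,i} - T_{k,i}` and `T_{k,i} - T_{k+1,i+1}`. -/
def gform (M : ℕ) (j : GTerm M) : GSpace M →L[ℝ] ℝ :=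
  match j with
  | (⟨r, i⟩, true) => gcoord M (r + 1) i - gcoord M r i
  | (⟨r, i⟩, false) => gcoord M r i - gcoord M (r + 1) (i + 1)

/-- Extension by zero of the spectral parameters to all natural numbers. -/
def extendNat {M : ℕ} (lam : Fin (M + 1) → ℝ) (r : ℕ) : ℝ :=
  if h : r < M + 1 then lam ⟨r, h⟩ else 0

/-- The phase of the Givental integrand. -/
def gphase {M : ℕ} (lam : Fin (M + 1) → ℝ) : GSpace M →L[ℝ] ℝ :=
  ∑ r ∈ Finset.range (M + 1), ∑ i ∈ Finset.range (r + 1), extendNat lam r • gcoord M r i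
    - ∑ r ∈ Finset.range M, ∑ i ∈ Finset.range (r + 1), extendNat lam (r + 1) • gcoord M r i

lemma gval_succ (M r i : ℕ) (x : Fin (M + 1) → ℝ) (T : GIdx (M + 1) → ℝ) :
    gval (M + 1) x T (r + 1) (i + 1) = gcoord M r i (x, T) := by
  unfold gval gcoord
  by_cases h : i ≤ r ∧ r < M
  · rw [dif_pos h, dif_pos (by omega)]
    rfl
  · rw [dif_neg h, dif_neg (by omega)]
    by_cases h' : r = M ∧ i ≤ M
    · rw [dif_pos h', dif_pos (by omega)]
      rfl
    · rw [dif_neg h', dif_neg (by omega)]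
      rfl

lemma gcoord_gbasis {M r i r' i' : ℕ} (hr : r' ≤ M) (hi : i' ≤ r') :
    gcoord M r' i' (gbasis M r i) = if r' = r ∧ i' = i then 1 else 0 := by
  unfold gcoord gbasis
  rcases hr.lt_or_eq with h | rfl
  · rw [dif_pos ⟨hi, h⟩]
    rfl
  · rw [dif_neg (by omega), dif_pos ⟨rfl, hi⟩]
    simp [eq_comm]

lemma gbasis_last {M : ℕ} (i : Fin (M + 1)) : gbasis M M i = (Pi.single i 1, 0) := by
  unfold gbasis
  ext k
  · simp [Pi.single_apply, Fin.ext_iff]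
  · have := k.2
    simp
    omega

lemma gbasis_of_lt {M r : ℕ} (hr : r < M) (i : ℕ) : gbasis M r i = (0, (gbasis M r i).2) := by
  unfold gbasis
  ext k
  · simp; omega
  · rfl

lemma sum_gterm {A : Type*} [AddCommMonoid A] (M : ℕ) (f : ℕ → ℕ → Bool → A) :
    ∑ j : GTerm M, f j.1.1 j.1.2 j.2
      = ∑ r ∈ Finset.range M, ∑ i ∈ Finset.range (r + 1), (f r i true + f r i false) := by
  rw [Fintype.sum_prod_type, Fintype.sum_sigma, Finset.sum_range]
  refine Finset.sum_congr rfl fun r _ => ?_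
  rw [Finset.sum_range]
  exact Finset.sum_congr rfl fun i _ => by simp

lemma gform_apply (M : ℕ) (j : GTerm M) (z : GSpace M) :
    gform M j z = bif j.2 then gcoord M (j.1.1 + 1) j.1.2 z - gcoord M j.1.1 j.1.2 z
      else gcoord M j.1.1 j.1.2 z - gcoord M (j.1.1 + 1) (j.1.2 + 1) z := by
  obtain ⟨⟨r, i⟩, b⟩ := j
  cases b <;> simp [gform]

lemma expCoercive_gform (M : ℕ) : ExpCoercive (gform M) := by
  refine ⟨M + 1, by positivity, fun T => ?_⟩
  set S := ∑ j, Real.exp (gform M j (0, T)) with hS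
  have hS0 : 0 ≤ S := Finset.sum_nonneg fun _ _ => (Real.exp_pos _).le
  have hle : ∀ j, gform M j (0, T) ≤ S := fun j =>
    ((le_add_of_nonneg_right zero_le_one).trans (Real.add_one_le_exp _)).trans
      (Finset.single_le_sum (f := fun j => Real.exp (gform M j (0, T)))
        (fun _ _ => (Real.exp_pos _).le) (Finset.mem_univ j))
  have key : ∀ d r i : ℕ, r + d = M → i ≤ r → |gcoord M r i (0, T)| ≤ d * S := by
    intro d
    induction d with
    | zero =>
      intro r i hr hi
      obtain rfl : r = M := by omega
      rw [gcoord, dif_neg (by omega), dif_pos ⟨rfl, hi⟩]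
      simp
    | succ d ih =>
      intro r i hr hi
      have h1 := hle (⟨⟨r, by omega⟩, ⟨i, by simp; omega⟩⟩, true)
      have h2 := hle (⟨⟨r, by omega⟩, ⟨i, by simp; omega⟩⟩, false)
      simp only [gform_apply, cond_true, cond_false] at h1 h2
      have h3 := abs_le.mp (ih (r + 1) i (by omega) (by omega))
      have h4 := abs_le.mp (ih (r + 1) (i + 1) (by omega) (by omega))
      push_cast
      rw [abs_le]
      constructor <;> linarith
  rw [pi_norm_le_iff_of_nonneg (by positivity)]
  rintro ⟨⟨r, i⟩, hi, hr⟩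
  have hr' : r.val < M := by simpa using hr
  have := key (M - r) r i (by omega) hi
  rw [gcoord, dif_pos ⟨hi, hr'⟩] at this
  refine le_trans this ?_
  gcongr
  have : ((M - r.val : ℕ) : ℝ) ≤ M := by exact_mod_cast Nat.sub_le _ _
  linarith

lemma givIntegrand_eq_expWave (M : ℕ) (hbar : ℝ) (lam x : Fin (M + 1) → ℝ)
    (T : GIdx (M + 1) → ℝ) :
    givIntegrand (M + 1) hbar lam x T
      = expWave (gform M) (hbar⁻¹ • gphase lam) hbar⁻¹ 0 (x, T) := by
  have hI : ∀ (n : ℕ) (f : ℕ → ℂ),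
      ∑ i ∈ Finset.Icc 1 n, f i = ∑ i ∈ Finset.range n, f (i + 1) := fun n f => by
    rw [← Finset.Ico_add_one_right_eq_Icc, Finset.sum_Ico_eq_sum_range]
    simp [add_comm]
  have h1 : ∑ a : Fin (M + 1), (lam a : ℂ) *
      ((∑ i ∈ Finset.Icc 1 (a.val + 1), (gval (M + 1) x T (a.val + 1) i : ℂ))
        - ∑ i ∈ Finset.Icc 1 a.val, (gval (M + 1) x T a.val i : ℂ)) = (gphase lam (x, T) : ℝ) := by
    have : ∀ a : Fin (M + 1), (lam a : ℂ) = (extendNat lam a : ℝ) := fun a => by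
      rw [extendNat, dif_pos a.2]
    simp only [this]
    rw [← Finset.sum_range (n := M + 1) fun a => ((extendNat lam a : ℝ) : ℂ) *
      ((∑ i ∈ Finset.Icc 1 (a + 1), (gval (M + 1) x T (a + 1) i : ℂ))
        - ∑ i ∈ Finset.Icc 1 a, (gval (M + 1) x T a i : ℂ))]
    simp only [hI, mul_sub, Finset.sum_sub_distrib, gval_succ]
    rw [Finset.sum_range_succ' (fun a => ((extendNat lam a : ℝ) : ℂ) *
      ∑ i ∈ Finset.range a, (gval (M + 1) x T a (i + 1) : ℂ))]
    simp [gphase, gval_succ, Finset.mul_sum]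
  have h2 : ∑ k ∈ Finset.Icc 1 (M + 1 - 1), ∑ i ∈ Finset.Icc 1 k,
        ((Real.exp (gval (M + 1) x T (k + 1) i - gval (M + 1) x T k i) : ℂ)
          + (Real.exp (gval (M + 1) x T k i - gval (M + 1) x T (k + 1) (i + 1)) : ℂ))
      = ((∑ j, Real.exp (gform M j (x, T)) : ℝ) : ℂ) := by
    simp only [gform_apply]
    rw [sum_gterm M fun r i b => Real.exp (bif b then gcoord M (r + 1) i (x, T)
      - gcoord M r i (x, T) else gcoord M r i (x, T) - gcoord M (r + 1) (i + 1) (x, T))]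
    simp only [hI, gval_succ, Nat.add_sub_cancel, cond_true, cond_false]
    push_cast
    rfl
  rw [givIntegrand, Fpot, h1, h2, expWave]
  congr 1
  simp [sub_div, Finset.sum_div]
  simp only [div_eq_mul_inv]
  rw [sub_eq_neg_add]
  congr 1
  · rw [neg_inj]
    exact Finset.sum_congr rfl fun _ _ => mul_comm _ _
  · ring

/-- The weight `exp (T_{k+1,i} - T_{k,i})`. -/
def upExp (M r i : ℕ) (z : GSpace M) : ℂ :=
  (Real.exp ((gcoord M (r + 1) i - gcoord M r i) z) : ℝ)

/-- The weight `exp (T_{k,i} - T_{k+1,i+1})`. -/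
def downExp (M r i : ℕ) (z : GSpace M) : ℂ :=
  (Real.exp ((gcoord M r i - gcoord M (r + 1) (i + 1)) z) : ℝ)

/-- The logarithmic derivative, in the row `r` variable with index `i`, of the part of the
integrand coupling rows `r - 1` and `r`. -/
def innerSymbol (M : ℕ) (L : ℕ → ℂ) (r i : ℕ) (z : GSpace M) : ℂ :=
  L r - (if i < r then upExp M (r - 1) i z else 0)
    + (if 0 < i then downExp M (r - 1) (i - 1) z else 0)

/-- The logarithmic derivative, in the row `r` variable with index `i`, of the part of the
integrand coupling rows `r` and `r + 1`. -/
def outerSymbol (M : ℕ) (L : ℕ → ℂ) (r i : ℕ) (z : GSpace M) : ℂ :=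
  -L (r + 1) + upExp M r i z - downExp M r i z

lemma sum_triangle_ite (K r i : ℕ) (f : ℕ → ℕ → ℂ) :
    ∑ r' ∈ Finset.range K, ∑ i' ∈ Finset.range (r' + 1),
        (if r' = r ∧ i' = i then f r' i' else 0)
      = if r < K ∧ i < r + 1 then f r i else 0 := by
  have h : ∀ r', ∑ i' ∈ Finset.range (r' + 1), (if r' = r ∧ i' = i then f r' i' else 0)
      = if r' = r then (if i < r + 1 then f r i else 0) else 0 := fun r' => by
    by_cases hr : r' = r
    · subst hr
      simp
    · simp [hr]
  rw [Finset.sum_congr rfl fun r' _ => h r', Finset.sum_ite_eq']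
  simp only [Finset.mem_range, ite_and]

lemma sum_triangle_congr {K : ℕ} {f g : ℕ → ℕ → ℂ}
    (h : ∀ r' < K, ∀ i' ≤ r', f r' i' = g r' i') :
    ∑ r' ∈ Finset.range K, ∑ i' ∈ Finset.range (r' + 1), f r' i'
      = ∑ r' ∈ Finset.range K, ∑ i' ∈ Finset.range (r' + 1), g r' i' :=
  Finset.sum_congr rfl fun r' hr => Finset.sum_congr rfl fun i' hi =>
    h r' (Finset.mem_range.mp hr) i' (Nat.lt_succ_iff.mp (Finset.mem_range.mp hi))

lemma sum_triangle_succ_ite {K r i : ℕ} (hr : r ≤ K) (f : ℕ → ℕ → ℂ) :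
    ∑ r' ∈ Finset.range K, ∑ i' ∈ Finset.range (r' + 1),
        (if r' + 1 = r ∧ i' = i then f r' i' else 0)
      = if i < r then f (r - 1) i else 0 := by
  cases r with
  | zero => simp
  | succ r =>
    simp only [Nat.add_right_cancel_iff, Nat.add_sub_cancel]
    rw [sum_triangle_ite]
    simp only [Nat.lt_of_succ_le hr, true_and]

lemma sum_triangle_succ_succ_ite {K r i : ℕ} (hr : r ≤ K) (hi : i ≤ r) (f : ℕ → ℕ → ℂ) :
    ∑ r' ∈ Finset.range K, ∑ i' ∈ Finset.range (r' + 1),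
        (if r' + 1 = r ∧ i' + 1 = i then f r' i' else 0)
      = if 0 < i then f (r - 1) (i - 1) else 0 := by
  cases i with
  | zero => simp
  | succ i =>
    simp only [Nat.add_right_cancel_iff, Nat.add_sub_cancel]
    rw [sum_triangle_succ_ite hr]
    simp [Nat.lt_of_succ_le hi]

lemma gphase_gbasis {M : ℕ} (lam : Fin (M + 1) → ℝ) {r i : ℕ} (hr : r ≤ M) (hi : i ≤ r) :
    ((gphase lam (gbasis M r i) : ℝ) : ℂ)
      = extendNat lam r - if r < M then (extendNat lam (r + 1) : ℂ) else 0 := by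
  simp only [gphase, sub_apply, sum_apply, smul_apply, smul_eq_mul]
  push_cast
  rw [sum_triangle_congr (K := M + 1) (g := fun r' i' =>
      if r' = r ∧ i' = i then (extendNat lam r' : ℂ) else 0) fun r' h i' hi' => by
        rw [gcoord_gbasis (by omega) hi']; split_ifs <;> simp,
    sum_triangle_congr (K := M) (g := fun r' i' =>
      if r' = r ∧ i' = i then (extendNat lam (r' + 1) : ℂ) else 0) fun r' h i' hi' => by
        rw [gcoord_gbasis (by omega) hi']; split_ifs <;> simp,
    sum_triangle_ite, sum_triangle_ite]
  simp [hr, hi]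

lemma sum_gform_gbasis {M r i : ℕ} (hr : r ≤ M) (hi : i ≤ r) (z : GSpace M) :
    ∑ j, ((Real.exp (gform M j z) : ℝ) : ℂ) * (gform M j (gbasis M r i) : ℝ)
      = (if i < r then upExp M (r - 1) i z else 0)
        - (if 0 < i then downExp M (r - 1) (i - 1) z else 0)
        - if r < M then upExp M r i z - downExp M r i z else 0 := by
  simp only [gform_apply]
  rw [sum_gterm M fun r' i' b =>
    ((Real.exp (bif b then gcoord M (r' + 1) i' z
      - gcoord M r' i' z else gcoord M r' i' z - gcoord M (r' + 1) (i' + 1) z) : ℝ) : ℂ) *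
    ((bif b then gcoord M (r' + 1) i' (gbasis M r i)
      - gcoord M r' i' (gbasis M r i) else gcoord M r' i' (gbasis M r i)
        - gcoord M (r' + 1) (i' + 1) (gbasis M r i) : ℝ) : ℂ)]
  rw [sum_triangle_congr (K := M) (g := fun r' i' =>
    (if r' + 1 = r ∧ i' = i then upExp M r' i' z else 0)
      - (if r' = r ∧ i' = i then upExp M r' i' z else 0)
      + (if r' = r ∧ i' = i then downExp M r' i' z else 0)
      - (if r' + 1 = r ∧ i' + 1 = i then downExp M r' i' z else 0)) fun r' h i' hi' => by
      simp only [cond_true, cond_false]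
      rw [gcoord_gbasis (by omega) hi', gcoord_gbasis (by omega) (by omega),
        gcoord_gbasis (by omega) (by omega)]
      push_cast
      simp only [upExp, downExp, sub_apply, mul_sub, mul_ite, mul_one, mul_zero,
        apply_ite Complex.ofReal, Complex.ofReal_one, Complex.ofReal_zero, Complex.ofReal_exp,
        Complex.ofReal_sub]
      ring]
  simp only [Finset.sum_add_distrib, Finset.sum_sub_distrib]
  rw [sum_triangle_succ_ite hr, sum_triangle_ite, sum_triangle_ite,
    sum_triangle_succ_succ_ite hr hi]
  simp only [Nat.lt_succ_iff, hi, and_true]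
  split_ifs <;> ring

lemma hasLineDerivAt_exp {E : Type*} [NormedAddCommGroup E] [NormedSpace ℝ E] (q : E →L[ℝ] ℝ)
    (z w : E) : HasLineDerivAt ℝ (fun z => ((Real.exp (q z) : ℝ) : ℂ))
      (((Real.exp (q z) : ℝ) : ℂ) * (q w : ℝ)) z w := by
  have := (Complex.ofRealCLM.hasFDerivAt.comp z q.hasFDerivAt.exp).hasLineDerivAt w
  simpa [Function.comp_def] using this

lemma hasLineDerivAt_upExp {M : ℕ} (r i : ℕ) (z w : GSpace M) :
    HasLineDerivAt ℝ (upExp M r i)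
      (upExp M r i z * ((gcoord M (r + 1) i w - gcoord M r i w : ℝ) : ℂ)) z w :=
  hasLineDerivAt_exp _ z w

lemma hasLineDerivAt_downExp {M : ℕ} (r i : ℕ) (z w : GSpace M) :
    HasLineDerivAt ℝ (downExp M r i)
      (downExp M r i z * ((gcoord M r i w - gcoord M (r + 1) (i + 1) w : ℝ) : ℂ)) z w :=
  hasLineDerivAt_exp _ z w

lemma hasLineDerivAt_innerSymbol {M : ℕ} (L : ℕ → ℂ) {r i : ℕ} (hr : r ≤ M) (hi : i ≤ r)
    (z : GSpace M) :
    HasLineDerivAt ℝ (innerSymbol M L r i)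
      (-((if i < r then upExp M (r - 1) i z else 0)
        + (if 0 < i then downExp M (r - 1) (i - 1) z else 0))) z (gbasis M r i) := by
  have h1 : HasLineDerivAt ℝ (fun z => if i < r then upExp M (r - 1) i z else 0)
      (if i < r then upExp M (r - 1) i z else 0) z (gbasis M r i) := by
    by_cases h : i < r
    · simp only [h, if_true]
      convert hasLineDerivAt_upExp (r - 1) i z (gbasis M r i) using 1
      rw [gcoord_gbasis (by omega) (by omega), gcoord_gbasis (by omega) (by omega),
        if_pos (by omega), if_neg (by omega)]
      simp
    · simp only [h, if_false]
      exact (hasFDerivAt_const (0 : ℂ) z).hasLineDerivAt _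
  have h2 : HasLineDerivAt ℝ (fun z => if 0 < i then downExp M (r - 1) (i - 1) z else 0)
      (-if 0 < i then downExp M (r - 1) (i - 1) z else 0) z (gbasis M r i) := by
    by_cases h : 0 < i
    · simp only [h, if_true]
      convert hasLineDerivAt_downExp (r - 1) (i - 1) z (gbasis M r i) using 1
      rw [gcoord_gbasis (by omega) (by omega), gcoord_gbasis (by omega) (by omega),
        if_neg (by omega), if_pos (by omega)]
      simp
    · simp only [h, if_false, neg_zero]
      exact (hasFDerivAt_const (0 : ℂ) z).hasLineDerivAt _
  unfold HasLineDerivAt at h1 h2 ⊢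
  exact ((h1.const_sub (L r)).add h2).congr_deriv (by ring)

lemma hasLineDerivAt_outerSymbol {M : ℕ} (L : ℕ → ℂ) {r i : ℕ} (hr : r < M) (hi : i ≤ r)
    (z : GSpace M) :
    HasLineDerivAt ℝ (outerSymbol M L r i) (-(upExp M r i z + downExp M r i z)) z
      (gbasis M r i) := by
  have h1 := hasLineDerivAt_upExp r i z (gbasis M r i)
  have h2 := hasLineDerivAt_downExp r i z (gbasis M r i)
  rw [gcoord_gbasis (by omega) (by omega), gcoord_gbasis (by omega) (by omega),
    if_neg (by omega), if_pos (by omega)] at h1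
  rw [gcoord_gbasis (by omega) (by omega), gcoord_gbasis (by omega) (by omega),
    if_pos (by omega), if_neg (by omega)] at h2
  unfold HasLineDerivAt at h1 h2 ⊢
  exact ((h1.const_add (-L (r + 1))).sub h2).congr_deriv (by push_cast; ring)

/-- The Givental integrand as a function of all variables. -/
def gwave {M : ℕ} (hbar : ℝ) (lam : Fin (M + 1) → ℝ) : GSpace M → ℂ :=
  expWave (gform M) (hbar⁻¹ • gphase lam) hbar⁻¹ 0

/-- The span of the Givental integrand under multiplication by its exponential terms. -/
abbrev gspan {M : ℕ} (hbar : ℝ) (lam : Fin (M + 1) → ℝ) : Submodule ℂ (GSpace M → ℂ) :=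
  expSpan (gform M) (hbar⁻¹ • gphase lam) hbar⁻¹

/-- The spectral parameters multiplied by the imaginary unit. -/
def ispec {M : ℕ} (lam : Fin (M + 1) → ℝ) (r : ℕ) : ℂ := Complex.I * (extendNat lam r : ℝ)

lemma hasLineDerivAt_gwave {M : ℕ} (hbar : ℝ) (lam : Fin (M + 1) → ℝ) {r i : ℕ} (hr : r ≤ M)
    (hi : i ≤ r) (z : GSpace M) :
    HasLineDerivAt ℝ (gwave hbar lam)
      ((hbar : ℂ)⁻¹ * (innerSymbol M (ispec lam) r i z
        + if r < M then outerSymbol M (ispec lam) r i z else 0) * gwave hbar lam z) z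
      (gbasis M r i) := by
  classical
  have h := (hasFDerivAt_expWave (l := gform M) (p := hbar⁻¹ • gphase lam) (c := hbar⁻¹) 0
    z).hasLineDerivAt (gbasis M r i)
  unfold HasLineDerivAt at h ⊢
  refine h.congr_deriv ?_
  simp only [add_apply, sum_apply, smul_apply, ContinuousLinearMap.comp_apply,
    Complex.ofRealCLM_apply, smul_eq_mul, ← exp_mul_expWave, Pi.zero_apply, Nat.cast_zero,
    zero_mul, zero_sub]
  have e : ∀ j, -(((hbar⁻¹ : ℝ) : ℂ) * (((Real.exp (gform M j z) : ℝ) : ℂ) *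
        expWave (gform M) (hbar⁻¹ • gphase lam) hbar⁻¹ 0 z)) * (gform M j (gbasis M r i) : ℝ)
      = -((hbar : ℂ)⁻¹ * expWave (gform M) (hbar⁻¹ • gphase lam) hbar⁻¹ 0 z) *
        (((Real.exp (gform M j z) : ℝ) : ℂ) * (gform M j (gbasis M r i) : ℝ)) := fun j => by
    push_cast
    ring
  rw [Finset.sum_congr rfl fun j _ => e j, ← Finset.mul_sum, sum_gform_gbasis hr hi,
    Complex.ofReal_mul, gphase_gbasis lam hr hi]
  simp only [gwave, innerSymbol, outerSymbol, ispec]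
  push_cast
  split_ifs <;> ring

lemma exp_gform_mul_gwave_mem {M : ℕ} (hbar : ℝ) (lam : Fin (M + 1) → ℝ) (j : GTerm M) :
    (fun z => ((Real.exp (gform M j z) : ℝ) : ℂ) * gwave hbar lam z) ∈ gspan hbar lam := by
  classical
  simp only [gwave, exp_mul_expWave]
  exact expWave_mem_expSpan _

lemma upExp_mul_gwave_mem {M : ℕ} (hbar : ℝ) (lam : Fin (M + 1) → ℝ) {r i : ℕ} (hr : r < M)
    (hi : i ≤ r) : (fun z => upExp M r i z * gwave hbar lam z) ∈ gspan hbar lam :=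
  exp_gform_mul_gwave_mem hbar lam (⟨⟨r, hr⟩, ⟨i, Nat.lt_succ_of_le hi⟩⟩, true)

lemma downExp_mul_gwave_mem {M : ℕ} (hbar : ℝ) (lam : Fin (M + 1) → ℝ) {r i : ℕ} (hr : r < M)
    (hi : i ≤ r) : (fun z => downExp M r i z * gwave hbar lam z) ∈ gspan hbar lam :=
  exp_gform_mul_gwave_mem hbar lam (⟨⟨r, hr⟩, ⟨i, Nat.lt_succ_of_le hi⟩⟩, false)

lemma gwave_mem {M : ℕ} (hbar : ℝ) (lam : Fin (M + 1) → ℝ) : gwave hbar lam ∈ gspan hbar lam :=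
  expWave_mem_expSpan _

lemma innerSymbol_mul_gwave_mem {M : ℕ} (hbar : ℝ) (lam : Fin (M + 1) → ℝ) (L : ℕ → ℂ)
    {r i : ℕ} (hr : r ≤ M) (hi : i ≤ r) :
    (fun z => innerSymbol M L r i z * gwave hbar lam z) ∈ gspan hbar lam := by
  have h1 : (fun z => (if i < r then upExp M (r - 1) i z else 0) * gwave hbar lam z)
      ∈ gspan hbar lam := by
    by_cases h : i < r
    · simp only [h, if_true]
      exact upExp_mul_gwave_mem hbar lam (by omega) (by omega)
    · simp only [h, if_false, zero_mul]
      exact zero_mem _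
  have h2 : (fun z => (if 0 < i then downExp M (r - 1) (i - 1) z else 0) * gwave hbar lam z)
      ∈ gspan hbar lam := by
    by_cases h : 0 < i
    · simp only [h, if_true]
      exact downExp_mul_gwave_mem hbar lam (by omega) (by omega)
    · simp only [h, if_false, zero_mul]
      exact zero_mem _
  convert add_mem (sub_mem (Submodule.smul_mem _ (L r) (gwave_mem hbar lam)) h1) h2 using 1
  funext z
  simp only [innerSymbol, Pi.add_apply, Pi.sub_apply, Pi.smul_apply, smul_eq_mul]
  ring

lemma outerSymbol_mul_gwave_mem {M : ℕ} (hbar : ℝ) (lam : Fin (M + 1) → ℝ) (L : ℕ → ℂ)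
    {r i : ℕ} (hr : r < M) (hi : i ≤ r) :
    (fun z => outerSymbol M L r i z * gwave hbar lam z) ∈ gspan hbar lam := by
  convert sub_mem (add_mem (Submodule.smul_mem _ (-L (r + 1)) (gwave_mem hbar lam))
    (upExp_mul_gwave_mem hbar lam hr hi)) (downExp_mul_gwave_mem hbar lam hr hi) using 1
  funext z
  simp [outerSymbol]
  ring

/-- The action of `hbar² ∂²` on the inner layer of the integrand, at one vertex. -/
def innerQuad (M : ℕ) (L : ℕ → ℂ) (h : ℂ) (r i : ℕ) (z : GSpace M) : ℂ :=
  innerSymbol M L r i z ^ 2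
    - h * ((if i < r then upExp M (r - 1) i z else 0)
        + (if 0 < i then downExp M (r - 1) (i - 1) z else 0))

/-- The action of `hbar² ∂²` on the outer layer of the integrand, at one vertex. -/
def outerQuad (M : ℕ) (L : ℕ → ℂ) (h : ℂ) (r i : ℕ) (z : GSpace M) : ℂ :=
  outerSymbol M L r i z ^ 2 - h * (upExp M r i z + downExp M r i z)

lemma sum_inner_layer (x y : ℕ → ℝ) (L h : ℂ) (n : ℕ) :
    ∑ i ∈ Finset.range (n + 1),
      ((L - (if i < n then (Real.exp (x i - y i) : ℂ) else 0)
        + (if 0 < i then (Real.exp (y (i - 1) - x (i - 1 + 1)) : ℂ) else 0)) ^ 2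
        - h * ((if i < n then (Real.exp (x i - y i) : ℂ) else 0)
          + (if 0 < i then (Real.exp (y (i - 1) - x (i - 1 + 1)) : ℂ) else 0)))
    = ∑ i ∈ Finset.range n,
        ((-L + (Real.exp (x i - y i) : ℂ) - (Real.exp (y i - x (i + 1)) : ℂ)) ^ 2
          - h * ((Real.exp (x i - y i) : ℂ) + (Real.exp (y i - x (i + 1)) : ℂ)))
      + 2 * ∑ i ∈ Finset.range n, (Real.exp (x i - x (i + 1)) : ℂ)
      - 2 * ∑ i ∈ Finset.range (n - 1), (Real.exp (y i - y (i + 1)) : ℂ) + L ^ 2 := by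
  rw [Finset.sum_range_succ, Finset.sum_congr rfl fun i hi => by
    rw [if_pos (Finset.mem_range.mp hi)]]
  simp only [lt_irrefl, if_false]
  induction n with
  | zero => simp
  | succ n ih =>
    have hx : (Real.exp (x n - x (n + 1)) : ℂ)
        = (Real.exp (x n - y n) : ℂ) * (Real.exp (y n - x (n + 1)) : ℂ) := by
      rw [← Complex.ofReal_mul, ← Real.exp_add]
      congr 2
      ring
    simp only [Finset.sum_range_succ _ n, hx, Nat.add_sub_cancel, Nat.succ_pos, if_true]
    cases n with
    | zero => simp; ring
    | succ n =>
      have hy : (Real.exp (y n - y (n + 1)) : ℂ)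
          = (Real.exp (x (n + 1) - y (n + 1)) : ℂ) * (Real.exp (y n - x (n + 1)) : ℂ) := by
        rw [← Complex.ofReal_mul, ← Real.exp_add]
        congr 2
        ring
      simp only [Nat.add_sub_cancel, Nat.succ_pos, if_true] at ih ⊢
      rw [Finset.sum_range_succ (fun i => (Real.exp (y i - y (i + 1)) : ℂ)) n, hy]
      linear_combination ih

/-- The Toda potential of row `r`. -/
def rowPotential (M r : ℕ) (z : GSpace M) : ℂ :=
  ∑ i ∈ Finset.range r, (Real.exp (gcoord M r i z - gcoord M r (i + 1) z) : ℂ)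

lemma sum_innerQuad_succ (M : ℕ) (L : ℕ → ℂ) (h : ℂ) (r : ℕ) (z : GSpace M) :
    ∑ i ∈ Finset.range (r + 1 + 1), innerQuad M L h (r + 1) i z
      = ∑ i ∈ Finset.range (r + 1), outerQuad M L h r i z
        + 2 * rowPotential M (r + 1) z - 2 * rowPotential M r z + L (r + 1) ^ 2 :=
  sum_inner_layer (fun i => gcoord M (r + 1) i z) (fun i => gcoord M r i z) (L (r + 1)) h (r + 1)

lemma sum_innerQuad_sub_outerQuad (M : ℕ) (L : ℕ → ℂ) (h : ℂ) (n : ℕ) (z : GSpace M) :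
    ∑ i ∈ Finset.range (n + 1), innerQuad M L h n i z
      - ∑ r ∈ Finset.range n, ∑ i ∈ Finset.range (r + 1),
          (outerQuad M L h r i z - innerQuad M L h r i z)
      = 2 * rowPotential M n z + ∑ r ∈ Finset.range (n + 1), L r ^ 2 := by
  induction n with
  | zero => simp [innerQuad, innerSymbol, rowPotential]
  | succ n ih =>
    rw [sum_innerQuad_succ, Finset.sum_range_succ (fun r => L r ^ 2) (n + 1),
      Finset.sum_range_succ (fun r => ∑ i ∈ Finset.range (r + 1),
        (outerQuad M L h r i z - innerQuad M L h r i z)) n, Finset.sum_sub_distrib]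
    linear_combination ih

lemma fderiv_eq_of_hasLineDerivAt {M : ℕ} {hbar : ℝ} (hh : 0 < hbar) {lam : Fin (M + 1) → ℝ}
    {f : GSpace M → ℂ} (hf : f ∈ gspan hbar lam) {f' : ℂ} {z w : GSpace M}
    (h : HasLineDerivAt ℝ f f' z w) : fderiv ℝ f z w = f' := by
  have hd : DifferentiableAt ℝ f z := (expSpan_regular (μ := (volume : Measure
    (GIdx (M + 1) → ℝ))) (expCoercive_gform M) (inv_pos.mpr hh) hf).1.differentiable (by simp) z
  exact (hd.hasFDerivAt.hasLineDerivAt w).unique h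

lemma fderiv_gwave_last {M : ℕ} {hbar : ℝ} (hh : 0 < hbar) (lam : Fin (M + 1) → ℝ) {i : ℕ}
    (hi : i ≤ M) (z : GSpace M) :
    fderiv ℝ (gwave hbar lam) z (gbasis M M i)
      = (hbar : ℂ)⁻¹ * (innerSymbol M (ispec lam) M i z * gwave hbar lam z) := by
  rw [fderiv_eq_of_hasLineDerivAt hh (gwave_mem hbar lam)
    (hasLineDerivAt_gwave hbar lam le_rfl hi z), if_neg (lt_irrefl _)]
  ring

lemma fderiv_fderiv_gwave_last {M : ℕ} {hbar : ℝ} (hh : 0 < hbar) (lam : Fin (M + 1) → ℝ)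
    {i : ℕ} (hi : i ≤ M) (z : GSpace M) :
    (hbar : ℂ) ^ 2 *
        fderiv ℝ (fun z => fderiv ℝ (gwave hbar lam) z (gbasis M M i)) z (gbasis M M i)
      = innerQuad M (ispec lam) hbar M i z * gwave hbar lam z := by
  have h0 : (hbar : ℂ) ≠ 0 := by exact_mod_cast hh.ne'
  simp only [fderiv_gwave_last hh lam hi]
  rw [fderiv_eq_of_hasLineDerivAt
    (f := fun z => (hbar : ℂ)⁻¹ * (innerSymbol M (ispec lam) M i z * gwave hbar lam z)) hh
    (Submodule.smul_mem _ (hbar : ℂ)⁻¹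
      (innerSymbol_mul_gwave_mem hbar lam (ispec lam) le_rfl hi))
    (HasDerivAt.const_mul _ (HasDerivAt.mul
      (hasLineDerivAt_innerSymbol (ispec lam) le_rfl hi z)
      (hasLineDerivAt_gwave hbar lam le_rfl hi z)) :)]
  simp only [lt_irrefl, if_false, zero_smul, add_zero, innerQuad]
  field_simp
  ring

lemma fderiv_symbol_mul_gwave {M : ℕ} {hbar : ℝ} (hh : 0 < hbar) (lam : Fin (M + 1) → ℝ)
    {r i : ℕ} (hr : r < M) (hi : i ≤ r) (z : GSpace M) :
    (hbar : ℂ) * fderiv ℝ (fun z => outerSymbol M (ispec lam) r i z * gwave hbar lam z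
        - innerSymbol M (ispec lam) r i z * gwave hbar lam z) z (gbasis M r i)
      = (outerQuad M (ispec lam) hbar r i z - innerQuad M (ispec lam) hbar r i z) *
          gwave hbar lam z := by
  have h0 : (hbar : ℂ) ≠ 0 := by exact_mod_cast hh.ne'
  have hG := hasLineDerivAt_gwave hbar lam hr.le hi z
  rw [fderiv_eq_of_hasLineDerivAt (f := fun z => outerSymbol M (ispec lam) r i z *
      gwave hbar lam z - innerSymbol M (ispec lam) r i z * gwave hbar lam z) hh (sub_mem
      (outerSymbol_mul_gwave_mem hbar lam (ispec lam) hr hi)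
      (innerSymbol_mul_gwave_mem hbar lam (ispec lam) hr.le hi))
    (HasDerivAt.sub (HasDerivAt.mul (hasLineDerivAt_outerSymbol (ispec lam) hr hi z) hG)
      (HasDerivAt.mul (hasLineDerivAt_innerSymbol (ispec lam) hr.le hi z) hG) :)]
  simp only [hr, if_true, zero_smul, add_zero, innerQuad, outerQuad]
  field_simp
  ring

lemma gcoord_last {M i : ℕ} (hi : i ≤ M) (z : GSpace M) :
    gcoord M M i z = z.1 ⟨i, Nat.lt_succ_of_le hi⟩ := by
  rw [gcoord, dif_neg (by omega), dif_pos ⟨rfl, hi⟩]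
  rfl

lemma givPsi_eq_integral_gwave (M : ℕ) (hbar : ℝ) (lam : Fin (M + 1) → ℝ) :
    GivPsi (M + 1) hbar lam = fun x => ∫ T, gwave hbar lam (x, T) := by
  funext x
  simp only [GivPsi, givIntegrand_eq_expWave, gwave]

lemma fderiv_mem_gspan {M : ℕ} {hbar : ℝ} (hh : 0 < hbar) {lam : Fin (M + 1) → ℝ}
    {f : GSpace M → ℂ} (hf : f ∈ gspan hbar lam) (w : GSpace M) :
    (fun z => fderiv ℝ f z w) ∈ gspan hbar lam :=
  (expSpan_regular (μ := (volume : Measure (GIdx (M + 1) → ℝ))) (expCoercive_gform M)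
    (inv_pos.mpr hh) hf).2.2.2 w

lemma integrable_of_mem_gspan {M : ℕ} {hbar : ℝ} (hh : 0 < hbar) {lam : Fin (M + 1) → ℝ}
    {f : GSpace M → ℂ} (hf : f ∈ gspan hbar lam) (x : Fin (M + 1) → ℝ) :
    Integrable fun T => f (x, T) :=
  integrable_of_mem_expSpan (expCoercive_gform M) (inv_pos.mpr hh) hf x

lemma fderiv_fderiv_givPsi {M : ℕ} {hbar : ℝ} (hh : 0 < hbar) (lam x : Fin (M + 1) → ℝ)
    (i : Fin (M + 1)) :
    fderiv ℝ (fun z => fderiv ℝ (GivPsi (M + 1) hbar lam) z (Pi.single i 1)) x (Pi.single i 1)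
      = ∫ T, fderiv ℝ (fun z => fderiv ℝ (gwave hbar lam) z (gbasis M M i)) (x, T)
          (gbasis M M i) := by
  rw [givPsi_eq_integral_gwave]
  have h : ∀ f ∈ gspan hbar lam, ∀ x : Fin (M + 1) → ℝ,
      fderiv ℝ (fun x => ∫ T, f (x, T)) x (Pi.single i 1)
        = ∫ T, fderiv ℝ f (x, T) (gbasis M M i) := fun f hf x => by
    rw [gbasis_last]
    exact fderiv_integral_of_mem_expSpan (expCoercive_gform M) (inv_pos.mpr hh) hf x _
  simp only [h _ (gwave_mem hbar lam)]
  exact h _ (fderiv_mem_gspan hh (gwave_mem hbar lam) _) x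

lemma sum_fderiv_fderiv_givPsi {M : ℕ} {hbar : ℝ} (hh : 0 < hbar) (lam x : Fin (M + 1) → ℝ) :
    (hbar : ℂ) ^ 2 * ∑ i : Fin (M + 1),
        fderiv ℝ (fun z => fderiv ℝ (GivPsi (M + 1) hbar lam) z (Pi.single i 1)) x
          (Pi.single i 1)
      = (2 * rowPotential M M (x, 0) + ∑ r ∈ Finset.range (M + 1), ispec lam r ^ 2) *
          GivPsi (M + 1) hbar lam x := by
  have hle : ∀ {r i : ℕ}, i ∈ Finset.range (r + 1) → i ≤ r := fun h =>
    Nat.lt_succ_iff.mp (Finset.mem_range.mp h)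
  have hD : ∀ i ∈ Finset.range (M + 1), Integrable (fun T =>
      innerQuad M (ispec lam) hbar M i (x, T) * gwave hbar lam (x, T)) := fun i hi => by
    simp only [← fderiv_fderiv_gwave_last hh lam (hle hi)]
    exact (integrable_of_mem_gspan hh (fderiv_mem_gspan hh (fderiv_mem_gspan hh
      (gwave_mem hbar lam) _) _) x).const_mul _
  have hV : ∀ r ∈ Finset.range M, ∀ i ∈ Finset.range (r + 1),
      Integrable (fun T => (outerQuad M (ispec lam) hbar r i (x, T)
        - innerQuad M (ispec lam) hbar r i (x, T)) * gwave hbar lam (x, T)) ∧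
      ∫ T, (outerQuad M (ispec lam) hbar r i (x, T)
        - innerQuad M (ispec lam) hbar r i (x, T)) * gwave hbar lam (x, T) = 0 := by
    intro r hr i hi
    have hr' := Finset.mem_range.mp hr
    have hm := sub_mem (outerSymbol_mul_gwave_mem hbar lam (ispec lam) hr' (hle hi))
      (innerSymbol_mul_gwave_mem hbar lam (ispec lam) hr'.le (hle hi))
    simp only [← fderiv_symbol_mul_gwave hh lam hr' (hle hi)]
    refine ⟨(integrable_of_mem_gspan hh (fderiv_mem_gspan hh hm _) x).const_mul _, ?_⟩
    rw [integral_const_mul, gbasis_of_lt hr']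
    exact mul_eq_zero_of_right _ (integral_fderiv_fiber_eq_zero (expCoercive_gform M)
      (inv_pos.mpr hh) hm x _)
  have hpot : ∀ T, rowPotential M M (x, T) = rowPotential M M (x, 0) := fun T => by
    refine Finset.sum_congr rfl fun i hi => ?_
    have := Finset.mem_range.mp hi
    simp only [gcoord_last (M := M) (i := i) (by omega),
      gcoord_last (M := M) (i := i + 1) (by omega)]
  have hsum : (hbar : ℂ) ^ 2 * ∑ i : Fin (M + 1),
        fderiv ℝ (fun z => fderiv ℝ (GivPsi (M + 1) hbar lam) z (Pi.single i 1)) x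
          (Pi.single i 1)
      = ∑ i ∈ Finset.range (M + 1),
          ∫ T, innerQuad M (ispec lam) hbar M i (x, T) * gwave hbar lam (x, T) := by
    rw [Finset.sum_range, Finset.mul_sum]
    refine Finset.sum_congr rfl fun i _ => ?_
    rw [fderiv_fderiv_givPsi hh, ← integral_const_mul]
    simp only [fderiv_fderiv_gwave_last hh lam (Nat.lt_succ_iff.mp i.2)]
  have hzero : ∑ r ∈ Finset.range M, ∑ i ∈ Finset.range (r + 1),
      ∫ T, (outerQuad M (ispec lam) hbar r i (x, T)
        - innerQuad M (ispec lam) hbar r i (x, T)) * gwave hbar lam (x, T) = 0 :=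
    Finset.sum_eq_zero fun r hr => Finset.sum_eq_zero fun i hi => (hV r hr i hi).2
  rw [hsum, ← sub_zero (∑ i ∈ Finset.range (M + 1), _), ← hzero, ← integral_finsetSum _ hD,
    Finset.sum_congr rfl fun r hr =>
      (integral_finsetSum (Finset.range (r + 1)) fun i hi => (hV r hr i hi).1).symm,
    ← integral_finsetSum _ fun r hr => integrable_finsetSum _ fun i hi => (hV r hr i hi).1,
    ← integral_sub (integrable_finsetSum _ hD)
      (integrable_finsetSum _ fun r hr => integrable_finsetSum _ fun i hi => (hV r hr i hi).1),
    givPsi_eq_integral_gwave, ← integral_const_mul]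
  congr 1
  funext T
  rw [← hpot T, ← sum_innerQuad_sub_outerQuad M (ispec lam) hbar M (x, T)]
  simp only [← Finset.sum_mul]
  exact (sub_mul _ _ _).symm

end Givental

/-- the Givental integral `Ψ^{(N)}_λ` is a smooth function of `x ∈ ℝ^N` and
is an eigenfunction of the quadratic open Toda Hamiltonian:
`−(ℏ²/2) Σ_i ∂²Ψ/∂x_i² + (Σ_{i=1}^{N−1} e^{x_i−x_{i+1}}) Ψ = ((1/2) Σ_k λ_k²) Ψ`. -/
theorem givental_toda_eigenfunction (N : ℕ) (hN : 2 ≤ N)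
    (hbar : ℝ) (hhbar : 0 < hbar) (lam : Fin N → ℝ) :
    ContDiff ℝ (⊤ : ℕ∞) (GivPsi N hbar lam) ∧
    ∀ x : Fin N → ℝ,
      -(((hbar : ℂ)) ^ 2 / 2) *
          ∑ i : Fin N,
            fderiv ℝ (fun z => fderiv ℝ (GivPsi N hbar lam) z (Pi.single i 1)) x
              (Pi.single i 1)
        + (∑ i : Fin N,
            if h : i.val + 1 < N then (Real.exp (x i - x ⟨i.val + 1, h⟩) : ℂ) else 0) *
            GivPsi N hbar lam x
      = ((1 / 2 : ℂ) * ∑ k : Fin N, (lam k : ℂ) ^ 2) * GivPsi N hbar lam x := by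
  obtain ⟨M, rfl⟩ : ∃ M, N = M + 1 := ⟨N - 1, by omega⟩
  refine ⟨?_, fun x => ?_⟩
  · rw [givPsi_eq_integral_gwave]
    exact contDiff_integral_of_mem_expSpan (expCoercive_gform M) (inv_pos.mpr hhbar)
      (gwave_mem hbar lam)
  have hpot : (∑ i : Fin (M + 1),
      if h : i.val + 1 < M + 1 then (Real.exp (x i - x ⟨i.val + 1, h⟩) : ℂ) else 0)
      = rowPotential M M (x, 0) := by
    rw [Fin.sum_univ_castSucc, rowPotential, Finset.sum_range]
    simp only [Fin.val_last, lt_irrefl, dite_false, add_zero]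
    refine Finset.sum_congr rfl fun i _ => ?_
    rw [dif_pos (by simp), gcoord_last (by omega), gcoord_last (by omega)]
    rfl
  have hspec : ∑ r ∈ Finset.range (M + 1), ispec lam r ^ 2 = -∑ k, (lam k : ℂ) ^ 2 := by
    rw [Finset.sum_range, ← Finset.sum_neg_distrib]
    refine Finset.sum_congr rfl fun k _ => ?_
    rw [ispec, extendNat, dif_pos k.2, mul_pow, Complex.I_sq]
    ring
  have h := sum_fderiv_fderiv_givPsi hhbar lam x
  rw [hspec] at h
  rw [hpot]
  linear_combination (-1 / 2 : ℂ) * h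
end
end

section
/- Fix N ≥ 2, ℏ > 0 and u, v ∈ ℂ. Let f : ℝ^{N−1} → ℂ be smooth, and suppose there exist constants C > 0 and a > 0 such that |∂^α f(y)| ≤ C e^{a Σ_{i=1}^{N−1} |y_i|} for all y ∈ ℝ^{N−1} and all partial-derivative multi-indices α of order at most N. Then the function (𝒬_v f)(x) = ∫_{ℝ^{N−1}} Q_v^{(N)}(x; y) f(y) dy is well defined and smooth on ℝ^N, and the intertwining relation A_N(u)(𝒬_v f) = (u − v) · 𝒬_v ( A_{N−1}(u) f ) holds, where A_N(u) acts in the x-variables and A_{N−1}(u) acts in the y-variables. -/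
open MeasureTheory

noncomputable section

/-- The coordinate `x_n` (1-based), read as `0` when out of range. -/
def xc (M : ℕ) (x : Fin M → ℝ) (n : ℕ) : ℝ :=
  if h : 1 ≤ n ∧ n - 1 < M then x ⟨n - 1, h.2⟩ else 0

/-- The momentum operator `p_n = −iℏ ∂/∂x_n` (1-based), read as `0` when out of range. -/
def pOp (M : ℕ) (hbar : ℝ) (f : (Fin M → ℝ) → ℂ) (n : ℕ) (x : Fin M → ℝ) : ℂ :=
  if h : 1 ≤ n ∧ n - 1 < M then
    -Complex.I * (hbar : ℂ) * fderiv ℝ f x (Pi.single ⟨n - 1, h.2⟩ 1)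
  else 0

/-- The operators `A_n(u)` defined by `A_{-1}(u) = 0`, `A_0(u) = 1` and
`A_n(u) = (u − p_n) A_{n−1}(u) − e^{x_{n−1} − x_n} A_{n−2}(u)`; `A_N(u)` is the generating
function `Σ_{n=0}^{N} (−1)^n u^{N−n} H_n^{(N)}` of the open Toda chain Hamiltonians. -/
def Aop (M : ℕ) (hbar : ℝ) (u : ℂ) : ℕ → ((Fin M → ℝ) → ℂ) → (Fin M → ℝ) → ℂ
  | 0, f, x => f x
  | 1, f, x => u * f x - pOp M hbar f 1 x
  | (n + 2), f, x =>
      u * Aop M hbar u (n + 1) f x - pOp M hbar (Aop M hbar u (n + 1) f) (n + 2) x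
        - (Real.exp (xc M x (n + 1) - xc M x (n + 2)) : ℂ) * Aop M hbar u n f x

/-- The kernel
`Q^{(N)}_v(x; y) = exp( (i v/ℏ)(Σ_{i=1}^N x_i − Σ_{i=1}^{N−1} y_i)
  − (1/ℏ) Σ_{i=1}^{N−1} (e^{x_i − y_i} + e^{y_i − x_{i+1}}) )`. -/
def Qker (N : ℕ) (hbar : ℝ) (v : ℂ) (x : Fin N → ℝ) (y : Fin (N - 1) → ℝ) : ℂ :=
  Complex.exp
    (Complex.I * v / (hbar : ℂ) * ((∑ i : Fin N, (x i : ℂ)) - ∑ i : Fin (N - 1), (y i : ℂ))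
      - (1 / (hbar : ℂ)) * ∑ i : Fin (N - 1),
          ((Real.exp (x (Fin.castLE (Nat.sub_le N 1) i) - y i) : ℂ)
            + (Real.exp (y i - if h : i.val + 1 < N then x ⟨i.val + 1, h⟩ else 0) : ℂ)))

/-- `φ` is bounded above by an exponential of the norm. -/
def ExpBounded {E : Type*} [NormedAddCommGroup E] (φ : E → ℝ) : Prop :=
  ∃ C a : ℝ, 0 ≤ C ∧ 0 ≤ a ∧ ∀ z, φ z ≤ C * Real.exp (a * ‖z‖)

/-- `f` is smooth, and its derivatives of order at most `m` grow at most exponentially. -/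
def ExpGrowth {E G : Type*} [NormedAddCommGroup E] [NormedSpace ℝ E] [NormedAddCommGroup G]
    [NormedSpace ℝ G] (m : ℕ∞) (f : E → G) : Prop :=
  ContDiff ℝ (⊤ : ℕ∞) f ∧
    ∀ k : ℕ, (k : ℕ∞) ≤ m → ExpBounded fun z => ‖iteratedFDeriv ℝ k f z‖

namespace ExpBounded

variable {E : Type*} [NormedAddCommGroup E] {φ ψ : E → ℝ}

theorem mono (hψ : ExpBounded ψ) (h : ∀ z, φ z ≤ ψ z) : ExpBounded φ := by
  obtain ⟨C, a, hC, ha, hb⟩ := hψ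
  exact ⟨C, a, hC, ha, fun z => (h z).trans (hb z)⟩

theorem const (c : ℝ) : ExpBounded fun _ : E => c :=
  ⟨|c|, 0, abs_nonneg c, le_rfl, fun z => by simpa using le_abs_self c⟩

theorem mul (hφ : ExpBounded φ) (hψ : ExpBounded ψ) (h0 : ∀ z, 0 ≤ ψ z) :
    ExpBounded fun z => φ z * ψ z := by
  obtain ⟨C, a, hC, ha, hb⟩ := hφ
  obtain ⟨D, b, hD, hb0, hd⟩ := hψ
  refine ⟨C * D, a + b, mul_nonneg hC hD, add_nonneg ha hb0, fun z => ?_⟩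
  calc φ z * ψ z ≤ (C * Real.exp (a * ‖z‖)) * (D * Real.exp (b * ‖z‖)) :=
        mul_le_mul (hb z) (hd z) (h0 z) (by positivity)
    _ = C * D * Real.exp ((a + b) * ‖z‖) := by rw [add_mul, Real.exp_add]; ring

theorem add (hφ : ExpBounded φ) (hψ : ExpBounded ψ) : ExpBounded fun z => φ z + ψ z := by
  obtain ⟨C, a, hC, ha, hb⟩ := hφ
  obtain ⟨D, b, hD, hb0, hd⟩ := hψ
  refine ⟨C + D, max a b, add_nonneg hC hD, le_max_of_le_left ha, fun z => ?_⟩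
  calc φ z + ψ z ≤ C * Real.exp (a * ‖z‖) + D * Real.exp (b * ‖z‖) := add_le_add (hb z) (hd z)
    _ ≤ C * Real.exp (max a b * ‖z‖) + D * Real.exp (max a b * ‖z‖) := by
        gcongr
        · exact le_max_left a b
        · exact le_max_right a b
    _ = _ := by ring

theorem sum {ι : Type*} (s : Finset ι) {Φ : ι → E → ℝ} (h : ∀ i ∈ s, ExpBounded (Φ i)) :
    ExpBounded fun z => ∑ i ∈ s, Φ i z := by
  classical
  induction s using Finset.induction_on with
  | empty => simpa using const 0
  | insert i s hi ih =>
    simp only [Finset.sum_insert hi]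
    exact (h i (by simp)).add (ih fun j hj => h j (by simp [hj]))

end ExpBounded

namespace ExpGrowth

variable {E G H K : Type*} [NormedAddCommGroup E] [NormedSpace ℝ E] [NormedAddCommGroup G]
  [NormedSpace ℝ G] [NormedAddCommGroup H] [NormedSpace ℝ H] [NormedAddCommGroup K]
  [NormedSpace ℝ K] {m : ℕ∞} {f : E → G} {g : E → G}

theorem expBounded (hf : ExpGrowth m f) : ExpBounded fun z => ‖f z‖ :=
  (hf.2 0 (by simp)).mono fun z => by simp

theorem mono {n : ℕ∞} (hf : ExpGrowth m f) (h : n ≤ m) : ExpGrowth n f :=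
  ⟨hf.1, fun k hk => hf.2 k (hk.trans h)⟩

theorem differentiable (hf : ExpGrowth m f) : Differentiable ℝ f :=
  hf.1.differentiable (by simp)

theorem const (c : G) : ExpGrowth m fun _ : E => c := by
  refine ⟨contDiff_const, fun k _ => ?_⟩
  cases k with
  | zero => exact (ExpBounded.const ‖c‖).mono fun z => by simp
  | succ k => exact (ExpBounded.const 0).mono fun z => by simp [iteratedFDeriv_succ_const]

theorem add (hf : ExpGrowth m f) (hg : ExpGrowth m g) : ExpGrowth m fun z => f z + g z := by
  refine ⟨hf.1.add hg.1, fun k hk => ((hf.2 k hk).add (hg.2 k hk)).mono fun z => ?_⟩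
  have := iteratedFDeriv_add_apply (x := z)
    (hf.1.of_le (m := k) (by exact_mod_cast le_top)).contDiffAt
    (hg.1.of_le (m := k) (by exact_mod_cast le_top)).contDiffAt
  change ‖iteratedFDeriv ℝ k (f + g) z‖ ≤ _
  rw [this]
  exact norm_add_le _ _

theorem sum {ι : Type*} (s : Finset ι) {F : ι → E → G} (h : ∀ i ∈ s, ExpGrowth m (F i)) :
    ExpGrowth m fun z => ∑ i ∈ s, F i z := by
  classical
  induction s using Finset.induction_on with
  | empty => simpa using const 0
  | insert i s hi ih =>
    simp only [Finset.sum_insert hi]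
    exact (h i (by simp)).add (ih fun j hj => h j (by simp [hj]))

theorem bilin (B : G →L[ℝ] H →L[ℝ] K) {h : E → H} (hf : ExpGrowth m f) (hh : ExpGrowth m h) :
    ExpGrowth m fun z => B (f z) (h z) := by
  refine ⟨B.isBoundedBilinearMap.contDiff.comp (hf.1.prodMk hh.1), fun k hk => ?_⟩
  refine ExpBounded.mono ?_ fun z =>
    B.norm_iteratedFDeriv_le_of_bilinear hf.1 hh.1 z (n := k) (by exact_mod_cast le_top)
  refine (ExpBounded.const _).mul (ExpBounded.sum _ fun i hi => ?_) fun z =>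
    Finset.sum_nonneg fun i _ => by positivity
  have hi' : i ≤ k := Nat.lt_succ_iff.1 (Finset.mem_range.1 hi)
  refine ((ExpBounded.const _).mul (hf.2 i ?_) fun _ => norm_nonneg _).mul (hh.2 (k - i) ?_)
    fun _ => norm_nonneg _
  · exact le_trans (by exact_mod_cast hi') hk
  · exact le_trans (by exact_mod_cast Nat.sub_le k i) hk

theorem smul {c : E → ℂ} [NormedSpace ℂ G] (hc : ExpGrowth m c) (hf : ExpGrowth m f) :
    ExpGrowth m fun z => c z • f z :=
  hc.bilin (ContinuousLinearMap.lsmul ℝ ℂ) hf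

theorem mul {c d : E → ℂ} (hc : ExpGrowth m c) (hd : ExpGrowth m d) :
    ExpGrowth m fun z => c z * d z :=
  hc.smul hd

theorem clm (L : G →L[ℝ] H) (hf : ExpGrowth m f) : ExpGrowth m fun z => L (f z) :=
  ⟨L.contDiff.comp hf.1, fun k hk =>
    ((ExpBounded.const ‖L‖).mul (hf.2 k hk) fun _ => norm_nonneg _).mono fun z =>
      L.norm_iteratedFDeriv_comp_left hf.1.contDiffAt (by exact_mod_cast le_top)⟩

theorem clm_apply {L : E → H →L[ℝ] G} (hL : ExpGrowth m L) (w : H) : ExpGrowth m fun z => L z w :=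
  hL.clm (ContinuousLinearMap.apply ℝ G w)

theorem fderiv {n : ℕ∞} (hf : ExpGrowth n f) (h : m + 1 ≤ n) :
    ExpGrowth m fun z => fderiv ℝ f z := by
  refine ⟨hf.1.fderiv_right (by exact_mod_cast le_top), fun k hk => ?_⟩
  simp only [norm_iteratedFDeriv_fderiv]
  exact hf.2 (k + 1) (le_trans (by push_cast; gcongr) h)

theorem cexp (L : E →L[ℝ] ℂ) : ExpGrowth m fun z => Complex.exp (L z) := by
  have hs : ContDiff ℝ (⊤ : ℕ∞) fun z => Complex.exp (L z) := L.contDiff.cexp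
  refine ⟨hs, fun k hk => ?_⟩
  clear hk
  induction k with
  | zero =>
    refine ⟨1, ‖L‖, zero_le_one, norm_nonneg _, fun z => ?_⟩
    simp only [norm_iteratedFDeriv_zero, one_mul, Complex.norm_exp]
    exact Real.exp_le_exp.2 ((Complex.re_le_norm _).trans (L.le_opNorm z))
  | succ k ih =>
    let T : ℂ →L[ℝ] E →L[ℝ] ℂ := (ContinuousLinearMap.lsmul ℝ ℂ).flip L
    have hd : (_root_.fderiv ℝ fun z => Complex.exp (L z)) = T ∘ fun z => Complex.exp (L z) := by
      funext z
      exact (L.hasFDerivAt.cexp).fderiv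
    refine ((ExpBounded.const ‖T‖).mul ih fun _ => norm_nonneg _).mono fun z => ?_
    rw [← norm_iteratedFDeriv_fderiv, hd]
    exact T.norm_iteratedFDeriv_comp_left hs.contDiffAt (by exact_mod_cast le_top)

end ExpGrowth

/-- A kernel `Q` on `E × F` with logarithmic derivative `q` of exponential growth, decaying in the
second variable faster than any exponential, locally uniformly in the first variable. -/
structure IsDecayKernel {E F : Type*} [NormedAddCommGroup E] [NormedSpace ℝ E]
    [NormedAddCommGroup F] [NormedSpace ℝ F] [MeasureSpace F] (Q : E × F → ℂ)
    (q : E × F → (E × F →L[ℝ] ℂ)) : Prop where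
  growth : ExpGrowth ⊤ q
  hasFDerivAt : ∀ z, HasFDerivAt Q (Q z • q z) z
  decay : ∀ a R : ℝ, ∃ b : F → ℝ, Integrable b ∧
    ∀ x y, ‖x‖ ≤ R → ‖Q (x, y)‖ * Real.exp (a * ‖y‖) ≤ b y

/-- The derivation `P ↦ Q⁻¹ ∂_w (P Q)`, where `q` is the logarithmic derivative of `Q`. -/
def twist {V : Type*} [NormedAddCommGroup V] [NormedSpace ℝ V] (q : V → (V →L[ℝ] ℂ))
    (P : V → ℂ) (w : V) (z : V) : ℂ :=
  fderiv ℝ P z w + P z * q z w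

theorem ExpGrowth.twist {V : Type*} [NormedAddCommGroup V] [NormedSpace ℝ V]
    {q : V → (V →L[ℝ] ℂ)} {P : V → ℂ} (hq : ExpGrowth ⊤ q) (hP : ExpGrowth ⊤ P) (w : V) :
    ExpGrowth ⊤ (twist q P w) :=
  ((hP.fderiv (by simp)).clm_apply w).add (hP.mul (hq.clm_apply w))

theorem twist_mul {V : Type*} [NormedAddCommGroup V] [NormedSpace ℝ V] (Q : V → ℂ)
    (q : V → (V →L[ℝ] ℂ)) (P : V → ℂ) (z w : V) :
    twist q P w z * Q z = (P z • (Q z • q z) + Q z • fderiv ℝ P z) w := by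
  simp [twist]; ring

namespace IsDecayKernel

variable {E F : Type*} [NormedAddCommGroup E] [NormedSpace ℝ E] [NormedAddCommGroup F]
  [NormedSpace ℝ F] [MeasureSpace F] {Q : E × F → ℂ} {q : E × F → (E × F →L[ℝ] ℂ)}

theorem continuous (hQ : IsDecayKernel Q q) : Continuous Q :=
  continuous_iff_continuousAt.2 fun z => (hQ.hasFDerivAt z).continuousAt

theorem exists_bound (hQ : IsDecayKernel Q q) {p : E × F → ℝ} {g : F → ℂ}
    (hp : ExpBounded p) (hg : ExpBounded fun y => ‖g y‖) (R : ℝ) :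
    ∃ b : F → ℝ, Integrable b ∧
      ∀ x y, ‖x‖ ≤ R → p (x, y) * ‖Q (x, y)‖ * ‖g y‖ ≤ b y := by
  obtain ⟨C, a, hC, ha, hb⟩ := hp
  obtain ⟨D, d, hD, hd, hb'⟩ := hg
  obtain ⟨b, hbi, hbd⟩ := hQ.decay (a + d) R
  refine ⟨fun y => C * Real.exp (a * R) * D * b y, hbi.const_mul _, fun x y hx => ?_⟩
  have hxy : ‖(x, y)‖ ≤ R + ‖y‖ := by
    rw [Prod.norm_def]
    have := norm_nonneg x
    have := norm_nonneg y
    exact max_le (by linarith) (by linarith)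
  calc p (x, y) * ‖Q (x, y)‖ * ‖g y‖
      ≤ (C * Real.exp (a * (R + ‖y‖))) * ‖Q (x, y)‖ * (D * Real.exp (d * ‖y‖)) := by
        gcongr
        · exact (hb _).trans (by gcongr)
        · exact hb' y
    _ = C * Real.exp (a * R) * D * (‖Q (x, y)‖ * Real.exp ((a + d) * ‖y‖)) := by
        rw [mul_add, add_mul, Real.exp_add, Real.exp_add]; ring
    _ ≤ _ := mul_le_mul_of_nonneg_left (hbd x y hx) (by positivity)

theorem hasFDerivAt_mul (hQ : IsDecayKernel Q q) {P : E × F → ℂ} (hP : ExpGrowth ⊤ P)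
    (z : E × F) : HasFDerivAt (fun z => P z * Q z) (P z • (Q z • q z) + Q z • fderiv ℝ P z) z :=
  (hP.differentiable z).hasFDerivAt.mul (hQ.hasFDerivAt z)

variable [BorelSpace F]

theorem integrable (hQ : IsDecayKernel Q q) {P : E × F → ℂ} {g : F → ℂ} {m m' : ℕ∞}
    (hP : ExpGrowth m P) (hg : ExpGrowth m' g) (x : E) :
    Integrable fun y => P (x, y) * Q (x, y) * g y := by
  obtain ⟨b, hb, hbd⟩ := hQ.exists_bound hP.expBounded hg.expBounded ‖x‖
  have h1 := hP.1.continuous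
  have h2 := hQ.continuous
  have h3 := hg.1.continuous
  refine hb.mono' (Continuous.aestronglyMeasurable (by fun_prop)) (.of_forall fun y => ?_)
  simpa using hbd x y le_rfl

theorem integral_mul_fderiv [FiniteDimensional ℝ F] [(volume : Measure F).IsAddHaarMeasure]
    (hQ : IsDecayKernel Q q) {P : E × F → ℂ} {g : F → ℂ}
    {m : ℕ∞} (hP : ExpGrowth ⊤ P) (hm : 1 ≤ m) (hg : ExpGrowth m g) (x : E) (w : F) :
    ∫ y, P (x, y) * Q (x, y) * fderiv ℝ g y w
      = -∫ y, twist q P (0, w) (x, y) * Q (x, y) * g y := by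
  have hd : ∀ y, HasFDerivAt (fun y => P (x, y) * Q (x, y))
      ((P (x, y) • (Q (x, y) • q (x, y)) + Q (x, y) • fderiv ℝ P (x, y)).comp
        (ContinuousLinearMap.inr ℝ E F)) y := fun y =>
    (hQ.hasFDerivAt_mul hP (x, y)).comp y (hasFDerivAt_prodMk_right x y)
  have hd' : ∀ y, fderiv ℝ (fun y => P (x, y) * Q (x, y)) y w
      = twist q P (0, w) (x, y) * Q (x, y) := fun y => by
    rw [(hd y).fderiv, twist_mul]; rfl
  simp only [← hd']
  refine integral_mul_fderiv_eq_neg_fderiv_mul_of_integrable ?_ ?_ ?_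
    (fun y _ => (hd y).differentiableAt) fun y _ => hg.differentiable y
  · simp only [hd']
    exact hQ.integrable (hQ.growth.twist hP _) hg x
  · exact hQ.integrable hP ((hg.fderiv (m := 0) (by simpa using hm)).clm_apply w) x
  · exact hQ.integrable hP hg x

variable [SecondCountableTopology F]

theorem hasFDerivAt_integral (hQ : IsDecayKernel Q q) {P : E × F → ℂ} {g : F → ℂ}
    {m : ℕ∞} (hP : ExpGrowth ⊤ P) (hg : ExpGrowth m g) (x : E) :
    ∃ L : E →L[ℝ] ℂ, HasFDerivAt (fun x => ∫ y, P (x, y) * Q (x, y) * g y) L x ∧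
      ∀ w, L w = ∫ y, twist q P (w, 0) (x, y) * Q (x, y) * g y := by
  let D : E × F → (E × F →L[ℝ] ℂ) := fun z => P z • (Q z • q z) + Q z • fderiv ℝ P z
  let F' : E → F → (E →L[ℝ] ℂ) := fun x y =>
    g y • (D (x, y)).comp (ContinuousLinearMap.inl ℝ E F)
  have hPc := hP.1.continuous
  have hP'c := (hP.fderiv (m := ⊤) (by simp)).1.continuous
  have hQc := hQ.continuous
  have hqc := hQ.growth.1.continuous
  have hgc := hg.1.continuous
  have hDc : Continuous D := by fun_prop
  have hF'c : Continuous (F' x) := by fun_prop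
  obtain ⟨b, hb, hbd⟩ := hQ.exists_bound
    (((hP.expBounded.mul hQ.growth.expBounded fun _ => norm_nonneg _).add
      (hP.fderiv (m := ⊤) (by simp)).expBounded)) hg.expBounded (‖x‖ + 1)
  have hbound : ∀ x' y, ‖x'‖ ≤ ‖x‖ + 1 → ‖F' x' y‖ ≤ b y := by
    intro x' y hx'
    refine le_trans ?_ (hbd x' y hx')
    have h1 : ‖(D (x', y)).comp (ContinuousLinearMap.inl ℝ E F)‖ ≤ ‖D (x', y)‖ :=
      (ContinuousLinearMap.opNorm_comp_le _ _).trans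
        (mul_le_of_le_one_right (norm_nonneg _) (ContinuousLinearMap.norm_inl_le_one ℝ E F))
    have h2 : ‖D (x', y)‖ ≤ ‖P (x', y)‖ * (‖Q (x', y)‖ * ‖q (x', y)‖)
        + ‖Q (x', y)‖ * ‖fderiv ℝ P (x', y)‖ := by
      refine (norm_add_le _ _).trans ?_
      rw [norm_smul, norm_smul, norm_smul]
    calc ‖F' x' y‖ = ‖g y‖ * ‖(D (x', y)).comp (ContinuousLinearMap.inl ℝ E F)‖ := norm_smul _ _
      _ ≤ ‖g y‖ * (‖P (x', y)‖ * (‖Q (x', y)‖ * ‖q (x', y)‖)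
        + ‖Q (x', y)‖ * ‖fderiv ℝ P (x', y)‖) := by gcongr; exact h1.trans h2
      _ = _ := by ring
  have hs : Metric.closedBall x 1 ∈ nhds x := Metric.closedBall_mem_nhds x one_pos
  have hs' : ∀ x' ∈ Metric.closedBall x 1, ‖x'‖ ≤ ‖x‖ + 1 := fun x' hx' =>
    norm_le_of_mem_closedBall hx'
  have key := hasFDerivAt_integral_of_dominated_of_fderiv_le (μ := (volume : Measure F))
    (F := fun x y => P (x, y) * Q (x, y) * g y) (F' := F') (bound := b) hs
    (.of_forall fun x' => (hQ.integrable hP hg x').aestronglyMeasurable)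
    (hQ.integrable hP hg x) hF'c.aestronglyMeasurable
    (.of_forall fun y x' hx' => hbound x' y (hs' x' hx')) hb
    (.of_forall fun y x' _ => by
      have h := HasFDerivAt.comp (f := fun e : E => (e, y)) x' (hQ.hasFDerivAt_mul hP (x', y))
        (hasFDerivAt_prodMk_left x' y)
      exact h.mul_const (g y))
  refine ⟨_, key, fun w => ?_⟩
  have hint : Integrable (F' x) :=
    hb.mono' hF'c.aestronglyMeasurable (.of_forall fun y => hbound x y (by linarith))
  rw [ContinuousLinearMap.integral_apply hint]
  refine integral_congr_ae (.of_forall fun y => ?_)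
  have := twist_mul Q q P (x, y) (w, 0)
  simp only [F', smul_apply, ContinuousLinearMap.comp_apply,
    ContinuousLinearMap.inl_apply, D, this, smul_eq_mul]
  ring

theorem fderiv_integral_apply (hQ : IsDecayKernel Q q) {P : E × F → ℂ} {g : F → ℂ}
    {m : ℕ∞} (hP : ExpGrowth ⊤ P) (hg : ExpGrowth m g) (x w : E) :
    fderiv ℝ (fun x => ∫ y, P (x, y) * Q (x, y) * g y) x w
      = ∫ y, twist q P (w, 0) (x, y) * Q (x, y) * g y := by
  obtain ⟨L, hL, hLw⟩ := hQ.hasFDerivAt_integral hP hg x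
  rw [hL.fderiv, hLw]

theorem contDiff_integral [FiniteDimensional ℝ E] (hQ : IsDecayKernel Q q) {P : E × F → ℂ}
    {g : F → ℂ} {m : ℕ∞} (hP : ExpGrowth ⊤ P) (hg : ExpGrowth m g) :
    ContDiff ℝ (⊤ : ℕ∞) fun x => ∫ y, P (x, y) * Q (x, y) * g y := by
  refine contDiff_infty.2 fun n => ?_
  have hdiff : ∀ {P : E × F → ℂ}, ExpGrowth ⊤ P →
      Differentiable ℝ fun x => ∫ y, P (x, y) * Q (x, y) * g y := fun hP x =>
    let ⟨_, hL, _⟩ := hQ.hasFDerivAt_integral hP hg x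
    hL.differentiableAt
  induction n generalizing P with
  | zero => exact contDiff_zero.2 (hdiff hP).continuous
  | succ n ih =>
    push_cast
    refine contDiff_succ_iff_fderiv_apply.2 ⟨hdiff hP, by simp, fun w => ?_⟩
    simp only [hQ.fderiv_integral_apply hP hg]
    exact ih (hQ.growth.twist hP (w, 0))

end IsDecayKernel

theorem ExpGrowth.sub {E G : Type*} [NormedAddCommGroup E] [NormedSpace ℝ E]
    [NormedAddCommGroup G] [NormedSpace ℝ G] {m : ℕ∞} {f g : E → G} (hf : ExpGrowth m f)
    (hg : ExpGrowth m g) : ExpGrowth m fun z => f z - g z := by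
  simpa [sub_eq_add_neg] using hf.add (hg.clm (-ContinuousLinearMap.id ℝ G))

namespace Toda

/-- The functional `x_i - y_i`. -/
def lam {M : ℕ} (i : Fin M) : (Fin (M + 1) → ℝ) × (Fin M → ℝ) →L[ℝ] ℂ :=
  Complex.ofRealCLM.comp
    ((ContinuousLinearMap.proj (R := ℝ) (φ := fun _ => ℝ) i.castSucc).comp
        (ContinuousLinearMap.fst ℝ _ _)
      - (ContinuousLinearMap.proj (R := ℝ) (φ := fun _ => ℝ) i).comp
        (ContinuousLinearMap.snd ℝ _ _))

/-- The functional `y_i - x_{i+1}`. -/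
def mu {M : ℕ} (i : Fin M) : (Fin (M + 1) → ℝ) × (Fin M → ℝ) →L[ℝ] ℂ :=
  Complex.ofRealCLM.comp
    ((ContinuousLinearMap.proj (R := ℝ) (φ := fun _ => ℝ) i).comp
        (ContinuousLinearMap.snd ℝ _ _)
      - (ContinuousLinearMap.proj (R := ℝ) (φ := fun _ => ℝ) i.succ).comp
        (ContinuousLinearMap.fst ℝ _ _))

/-- The functional `∑ x_i - ∑ y_i`. -/
def tot (M : ℕ) : (Fin (M + 1) → ℝ) × (Fin M → ℝ) →L[ℝ] ℂ :=
  Complex.ofRealCLM.comp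
    ((∑ i, ContinuousLinearMap.proj (R := ℝ) (φ := fun _ => ℝ) i).comp
        (ContinuousLinearMap.fst ℝ _ _)
      - (∑ i, ContinuousLinearMap.proj (R := ℝ) (φ := fun _ => ℝ) i).comp
        (ContinuousLinearMap.snd ℝ _ _))

@[simp] theorem lam_apply {M : ℕ} (i : Fin M) (z : (Fin (M + 1) → ℝ) × (Fin M → ℝ)) :
    lam i z = ((z.1 i.castSucc - z.2 i : ℝ) : ℂ) := rfl

@[simp] theorem mu_apply {M : ℕ} (i : Fin M) (z : (Fin (M + 1) → ℝ) × (Fin M → ℝ)) :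
    mu i z = ((z.2 i - z.1 i.succ : ℝ) : ℂ) := rfl

@[simp] theorem tot_apply {M : ℕ} (z : (Fin (M + 1) → ℝ) × (Fin M → ℝ)) :
    tot M z = ((∑ i, z.1 i - ∑ i, z.2 i : ℝ) : ℂ) := by
  simp [tot]

/-- The exponent of the kernel. -/
def phase (M : ℕ) (hbar : ℝ) (v : ℂ) (z : (Fin (M + 1) → ℝ) × (Fin M → ℝ)) : ℂ :=
  Complex.I * v / hbar * tot M z
    - 1 / (hbar : ℂ) * ∑ i : Fin M, (Complex.exp (lam i z) + Complex.exp (mu i z))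

/-- The logarithmic derivative of the kernel. -/
def logDeriv (M : ℕ) (hbar : ℝ) (v : ℂ) (z : (Fin (M + 1) → ℝ) × (Fin M → ℝ)) :
    (Fin (M + 1) → ℝ) × (Fin M → ℝ) →L[ℝ] ℂ :=
  (Complex.I * v / hbar) • tot M
    - (1 / (hbar : ℂ)) • ∑ i : Fin M,
      (Complex.exp (lam i z) • lam i + Complex.exp (mu i z) • mu i)

theorem qker_eq (M : ℕ) (hbar : ℝ) (v : ℂ) (x : Fin (M + 1) → ℝ) (y : Fin M → ℝ) :
    Qker (M + 1) hbar v x y = Complex.exp (phase M hbar v (x, y)) := by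
  simp only [Qker, phase, lam_apply, mu_apply, tot_apply]
  push_cast
  congr 3
  refine Finset.sum_congr rfl fun i _ => ?_
  rw [dif_pos (show i.val + 1 < M + 1 by have := i.2; omega)]
  rfl

theorem growth_logDeriv (M : ℕ) (hbar : ℝ) (v : ℂ) : ExpGrowth ⊤ (logDeriv M hbar v) :=
  (ExpGrowth.const _).sub ((ExpGrowth.const (1 / (hbar : ℂ))).smul (ExpGrowth.sum _ fun i _ =>
    ((ExpGrowth.cexp (lam i)).smul (.const _)).add ((ExpGrowth.cexp (mu i)).smul (.const _))))

theorem norm_kernel_le (M : ℕ) {hbar : ℝ} (hbar_pos : 0 < hbar) (v : ℂ) (a R : ℝ) :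
    ∃ D κ : ℝ, 0 < κ ∧ ∀ (x : Fin (M + 1) → ℝ) (y : Fin M → ℝ), ‖x‖ ≤ R →
      ‖Complex.exp (phase M hbar v (x, y))‖ * Real.exp (a * ‖y‖)
        ≤ Real.exp D * ∏ i, (Real.exp (-κ * y i ^ 2)) := by
  set c : ℝ := |(Complex.I * v / hbar).re| with hc
  set B : ℝ := c + |a| with hB
  set κ : ℝ := Real.exp (-R) / (2 * hbar) with hκ
  have hκ0 : 0 < κ := by positivity
  refine ⟨c * ((M + 1) * R) + M * (B ^ 2 / (2 * κ)), κ / 2, by positivity, fun x y hx => ?_⟩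
  have hxi : ∀ i, |x i| ≤ R := fun i => (norm_le_pi_norm x i).trans hx
  rw [Complex.norm_exp, ← Real.exp_add, ← Real.exp_sum, ← Real.exp_add]
  refine Real.exp_le_exp.2 ?_
  have hre : (phase M hbar v (x, y)).re = (Complex.I * v / hbar).re * (∑ i, x i - ∑ i, y i)
      - ∑ i : Fin M, 1 / hbar * (Real.exp (x i.castSucc - y i) + Real.exp (y i - x i.succ)) := by
    simp only [phase, lam_apply, mu_apply, tot_apply, ← Complex.ofReal_exp,
      ← Complex.ofReal_add, ← Complex.ofReal_sum, ← Complex.ofReal_one, ← Complex.ofReal_div,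
      Complex.sub_re, Complex.re_mul_ofReal, Complex.ofReal_re]
    rw [Finset.mul_sum]
  have hnorm : ‖y‖ ≤ ∑ i, |y i| :=
    (pi_norm_le_iff_of_nonneg (Finset.sum_nonneg fun i _ => abs_nonneg _)).2 fun i =>
      Finset.single_le_sum (f := fun i => |y i|) (fun i _ => abs_nonneg _) (Finset.mem_univ i)
  have h1 : (Complex.I * v / hbar).re * (∑ i, x i - ∑ i, y i)
      ≤ c * ((M + 1) * R + ∑ i, |y i|) := by
    refine (le_abs_self _).trans ?_
    rw [abs_mul]
    refine mul_le_mul_of_nonneg_left ((abs_sub _ _).trans (add_le_add ?_ ?_)) (abs_nonneg _)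
    · refine (Finset.abs_sum_le_sum_abs _ _).trans ?_
      refine (Finset.sum_le_sum fun i _ => hxi i).trans ?_
      simp
    · exact Finset.abs_sum_le_sum_abs _ _
  have h2 : a * ‖y‖ ≤ |a| * ∑ i, |y i| :=
    mul_le_mul (le_abs_self a) hnorm (norm_nonneg _) (abs_nonneg _)
  have h3 : ∀ i : Fin M, B * |y i|
      - 1 / hbar * (Real.exp (x i.castSucc - y i) + Real.exp (y i - x i.succ))
      ≤ B ^ 2 / (2 * κ) + -(κ / 2) * y i ^ 2 := by
    intro i
    have e1 : Real.exp (-R) * Real.exp (-y i) ≤ Real.exp (x i.castSucc - y i) := by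
      rw [← Real.exp_add]
      exact Real.exp_le_exp.2 (by linarith [(abs_le.1 (hxi i.castSucc)).1])
    have e2 : Real.exp (-R) * Real.exp (y i) ≤ Real.exp (y i - x i.succ) := by
      rw [← Real.exp_add]
      exact Real.exp_le_exp.2 (by linarith [(abs_le.1 (hxi i.succ)).2])
    have e3 : y i ^ 2 / 2 ≤ Real.exp (-y i) + Real.exp (y i) := by
      have p1 := Real.exp_pos (-y i)
      have p2 := Real.exp_pos (y i)
      rcases le_total 0 (y i) with h | h
      · have := Real.quadratic_le_exp_of_nonneg h
        linarith
      · have := Real.quadratic_le_exp_of_nonneg (neg_nonneg.2 h)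
        nlinarith
    have e4 : κ * y i ^ 2
        ≤ 1 / hbar * (Real.exp (x i.castSucc - y i) + Real.exp (y i - x i.succ)) := by
      calc κ * y i ^ 2 = 1 / hbar * (Real.exp (-R) * (y i ^ 2 / 2)) := by
            rw [hκ]; field_simp
        _ ≤ 1 / hbar * (Real.exp (-R) * (Real.exp (-y i) + Real.exp (y i))) := by gcongr
        _ ≤ _ := by
            rw [mul_add]
            gcongr
    have e5 : B * |y i| ≤ B ^ 2 / (2 * κ) + κ / 2 * y i ^ 2 := by
      have : B ^ 2 / (2 * κ) + κ / 2 * y i ^ 2 - B * |y i| = (B - κ * |y i|) ^ 2 / (2 * κ) := by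
        rw [← sq_abs (y i)]
        field_simp
        ring
      have h0 : 0 ≤ (B - κ * |y i|) ^ 2 / (2 * κ) := by positivity
      linarith
    linarith
  have h4 := Finset.sum_le_sum fun i (_ : i ∈ Finset.univ) => h3 i
  rw [Finset.sum_sub_distrib, Finset.sum_add_distrib, ← Finset.mul_sum] at h4
  simp only [Finset.sum_const, Finset.card_univ, Fintype.card_fin, nsmul_eq_mul] at h4
  rw [hre]
  have : B * ∑ i, |y i| = c * ∑ i, |y i| + |a| * ∑ i, |y i| := by rw [hB]; ring
  linarith

theorem isDecayKernel (M : ℕ) {hbar : ℝ} (hbar_pos : 0 < hbar) (v : ℂ) :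
    IsDecayKernel (fun z => Complex.exp (phase M hbar v z)) (logDeriv M hbar v) where
  growth := growth_logDeriv M hbar v
  hasFDerivAt z := by
    refine HasFDerivAt.cexp ?_
    refine ((tot M).hasFDerivAt.const_mul _).sub (HasFDerivAt.const_mul ?_ _)
    exact HasFDerivAt.fun_sum fun i _ => (lam i).hasFDerivAt.cexp.add (mu i).hasFDerivAt.cexp
  decay a R := by
    obtain ⟨D, κ, hκ, h⟩ := norm_kernel_le M hbar_pos v a R
    exact ⟨_, (Integrable.fintype_prod (f := fun (_ : Fin M) t => Real.exp (-κ * t ^ 2))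
      fun _ => integrable_exp_neg_mul_sq hκ).const_mul (Real.exp D), h⟩

/-- The recursion satisfied by the symbols of `A_n(u)` acting on the kernel in the variables `x`. -/
def symX (w : ℂ) (α β : ℕ → ℂ) : ℕ → ℂ
  | 0 => 1
  | 1 => w - Complex.I * α 0 + Complex.I * β 0
  | n + 2 => (w - Complex.I * α (n + 1) + Complex.I * β (n + 1)) * symX w α β (n + 1)
      - α n * β (n + 1) * symX w α β n

/-- The recursion satisfied by the symbols of the transpose of `A_n(u)` acting on the kernel in
the variables `y`. -/
def symY (w : ℂ) (α β : ℕ → ℂ) : ℕ → ℂ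
  | 0 => 1
  | 1 => w - Complex.I * α 0 + Complex.I * β 1
  | n + 2 => (w - Complex.I * α (n + 1) + Complex.I * β (n + 2)) * symY w α β (n + 1)
      - β (n + 1) * α (n + 1) * symY w α β n

theorem symX_symY (w : ℂ) (α β : ℕ → ℂ) (h0 : β 0 = 0) (n : ℕ) :
    symX w α β (n + 1) = w * symY w α β n - Complex.I * α n * symX w α β n ∧
      symY w α β (n + 1) = symX w α β (n + 1) + Complex.I * β (n + 1) * symY w α β n := by
  induction n with
  | zero => simp [symX, symY, h0]
  | succ n ih =>
    obtain ⟨h1, h2⟩ := ih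
    have h3 : symX w α β (n + 2)
        = w * symY w α β (n + 1) - Complex.I * α (n + 1) * symX w α β (n + 1) := by
      rw [symX]
      linear_combination -w * h2 + Complex.I * β (n + 1) * h1
        - α n * β (n + 1) * symX w α β n * Complex.I_sq
    refine ⟨h3, ?_⟩
    rw [h3, symY]
    linear_combination -Complex.I * α (n + 1) * h2
      + β (n + 1) * α (n + 1) * symY w α β n * (-Complex.I_sq)

/-- The weight `e^{x_n - y_n}` (0-based), read as `0` when out of range. -/
def al {M : ℕ} (n : ℕ) (z : (Fin (M + 1) → ℝ) × (Fin M → ℝ)) : ℂ :=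
  if h : n < M then Complex.exp (lam ⟨n, h⟩ z) else 0

/-- The weight `e^{y_{n-1} - x_n}` (0-based), read as `0` when out of range. -/
def be {M : ℕ} : ℕ → (Fin (M + 1) → ℝ) × (Fin M → ℝ) → ℂ
  | 0, _ => 0
  | n + 1, z => if h : n < M then Complex.exp (mu ⟨n, h⟩ z) else 0

variable {M : ℕ}

theorem growth_al (n : ℕ) : ExpGrowth ⊤ (al (M := M) n) := by
  unfold al
  split_ifs
  · exact ExpGrowth.cexp _
  · exact ExpGrowth.const _

theorem growth_be (n : ℕ) : ExpGrowth ⊤ (be (M := M) n) := by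
  cases n with
  | zero => exact ExpGrowth.const 0
  | succ n =>
    by_cases hn : n < M
    · have : be (n + 1) = fun z => Complex.exp (mu ⟨n, hn⟩ z) := funext fun z => dif_pos hn
      rw [this]
      exact ExpGrowth.cexp _
    · have : be (M := M) (n + 1) = fun _ => 0 := funext fun z => dif_neg hn
      rw [this]
      exact ExpGrowth.const 0

theorem growth_factor (w : ℂ) (m n : ℕ) :
    ExpGrowth ⊤ fun z : (Fin (M + 1) → ℝ) × (Fin M → ℝ) =>
      w - Complex.I * al m z + Complex.I * be n z :=
  ((ExpGrowth.const w).sub ((ExpGrowth.const _).mul (growth_al m))).add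
    ((ExpGrowth.const _).mul (growth_be n))

theorem growth_symX (w : ℂ) : ∀ n, ExpGrowth ⊤ fun z : (Fin (M + 1) → ℝ) × (Fin M → ℝ) =>
    symX w (al · z) (be · z) n
  | 0 => ExpGrowth.const 1
  | 1 => growth_factor w 0 0
  | n + 2 => ((growth_factor w _ _).mul (growth_symX w (n + 1))).sub
      (((growth_al _).mul (growth_be _)).mul (growth_symX w n))

theorem growth_symY (w : ℂ) : ∀ n, ExpGrowth ⊤ fun z : (Fin (M + 1) → ℝ) × (Fin M → ℝ) =>
    symY w (al · z) (be · z) n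
  | 0 => ExpGrowth.const 1
  | 1 => growth_factor w 0 1
  | n + 2 => ((growth_factor w _ _).mul (growth_symY w (n + 1))).sub
      (((growth_be _).mul (growth_al _)).mul (growth_symY w n))

/-- `P` is constant along the direction `w`. -/
def Invariant {V : Type*} [AddCommGroup V] [Module ℝ V] (P : V → ℂ) (w : V) : Prop :=
  ∀ (z : V) (t : ℝ), P (z + t • w) = P z

theorem Invariant.fderiv_eq_zero {V : Type*} [NormedAddCommGroup V] [NormedSpace ℝ V] {P : V → ℂ}
    {w z : V} (h : Invariant P w) (hP : DifferentiableAt ℝ P z) : fderiv ℝ P z w = 0 := by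
  rw [← hP.lineDeriv_eq_fderiv, lineDeriv]
  simp only [h z, deriv_const]

theorem al_invariant_x {n : ℕ} {j : Fin (M + 1)} (h : n ≠ j) :
    Invariant (al (M := M) n) (Pi.single j 1, 0) := by
  intro z t
  unfold al
  split_ifs with hn
  · simp [Fin.ext_iff, h]
  · rfl

theorem be_invariant_x {n : ℕ} {j : Fin (M + 1)} (h : n ≠ j) :
    Invariant (be (M := M) n) (Pi.single j 1, 0) := by
  intro z t
  cases n with
  | zero => rfl
  | succ n =>
    simp only [be]
    split_ifs with hn
    · simp [Fin.ext_iff, h]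
    · rfl

theorem al_invariant_y {n : ℕ} {j : Fin M} (h : n ≠ j) :
    Invariant (al (M := M) n) (0, Pi.single j 1) := by
  intro z t
  unfold al
  split_ifs with hn
  · have : (⟨n, hn⟩ : Fin M) ≠ j := fun e => h (by rw [← e])
    simp [this]
  · rfl

theorem be_invariant_y {n : ℕ} {j : Fin M} (h : n ≠ j + 1) :
    Invariant (be (M := M) n) (0, Pi.single j 1) := by
  intro z t
  cases n with
  | zero => rfl
  | succ n =>
    simp only [be]
    split_ifs with hn
    · have : (⟨n, hn⟩ : Fin M) ≠ j := fun e => h (by rw [← e])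
      simp [this]
    · rfl

theorem symX_invariant (w : ℂ) (j : Fin (M + 1)) : ∀ n : ℕ, n ≤ j →
    Invariant (fun z => symX w (al · z) (be · z) n) (Pi.single j 1, 0)
  | 0, _ => fun _ _ => rfl
  | 1, h => fun z t => by
    simp only [symX, al_invariant_x (show 0 ≠ j.val by omega) z t,
      be_invariant_x (show 0 ≠ j.val by omega) z t]
  | n + 2, h => fun z t => by
    have h1 := symX_invariant w j (n + 1) (by omega) z t
    have h2 := symX_invariant w j n (by omega) z t
    simp only at h1 h2
    simp only [symX, h1, h2, al_invariant_x (show n + 1 ≠ j.val by omega) z t,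
      al_invariant_x (show n ≠ j.val by omega) z t,
      be_invariant_x (show n + 1 ≠ j.val by omega) z t]

theorem logDeriv_x (hbar : ℝ) (v : ℂ) (z : (Fin (M + 1) → ℝ) × (Fin M → ℝ)) (j : Fin (M + 1)) :
    logDeriv M hbar v z (Pi.single j 1, 0)
      = Complex.I * v / hbar - 1 / (hbar : ℂ) * al j z + 1 / (hbar : ℂ) * be j z := by
  have h1 : ∑ i : Fin M, Complex.exp (lam i z) * lam i (Pi.single j 1, 0) = al j z := by
    unfold al
    split_ifs with h
    · rw [Finset.sum_eq_single ⟨j, h⟩]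
      · simp [show (⟨j, h⟩ : Fin M).castSucc = j from rfl]
      · intro i _ hi
        have : i.castSucc ≠ j := fun e => hi (Fin.ext (by simp [← e]))
        simp [this]
      · simp
    · refine Finset.sum_eq_zero fun i _ => ?_
      have : i.castSucc ≠ j := fun e => h (by simp [← e])
      simp [this]
  have h2 : ∑ i : Fin M, Complex.exp (mu i z) * mu i (Pi.single j 1, 0) = -be j z := by
    obtain ⟨j, hj⟩ := j
    cases j with
    | zero =>
      simp only [be, neg_zero]
      refine Finset.sum_eq_zero fun i _ => ?_
      simp [Fin.ext_iff]
    | succ j =>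
      have hj' : j < M := by omega
      simp only [be, dif_pos hj']
      rw [Finset.sum_eq_single ⟨j, hj'⟩]
      · simp
      · intro i _ hi
        have : i.val ≠ j := fun e => hi (Fin.ext e)
        simp [Fin.ext_iff, this]
      · simp
  have h3 : tot M (Pi.single j 1, 0) = 1 := by simp
  simp only [logDeriv, sub_apply, smul_apply, sum_apply, add_apply, smul_eq_mul,
    Finset.sum_add_distrib, h1, h2, h3]
  ring

theorem logDeriv_y (hbar : ℝ) (v : ℂ) (z : (Fin (M + 1) → ℝ) × (Fin M → ℝ)) (j : Fin M) :
    logDeriv M hbar v z (0, Pi.single j 1)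
      = -(Complex.I * v / hbar) + 1 / (hbar : ℂ) * al j z - 1 / (hbar : ℂ) * be (j + 1) z := by
  have h1 : ∑ i : Fin M, Complex.exp (lam i z) * lam i (0, Pi.single j 1) = -al j z := by
    rw [Finset.sum_eq_single j]
    · simp [al]
    · intro i _ hi
      simp [hi]
    · simp
  have h2 : ∑ i : Fin M, Complex.exp (mu i z) * mu i (0, Pi.single j 1) = be (j + 1) z := by
    rw [Finset.sum_eq_single j]
    · simp [be]
    · intro i _ hi
      simp [hi]
    · simp
  have h3 : tot M (0, Pi.single j 1) = -1 := by simp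
  simp only [logDeriv, sub_apply, smul_apply, sum_apply, add_apply, smul_eq_mul,
    Finset.sum_add_distrib, h1, h2, h3]
  ring

theorem exp_xc_x {n : ℕ} (h : n < M) (z : (Fin (M + 1) → ℝ) × (Fin M → ℝ)) :
    ((Real.exp (xc (M + 1) z.1 (n + 1) - xc (M + 1) z.1 (n + 2)) : ℝ) : ℂ)
      = al n z * be (n + 1) z := by
  have h1 : xc (M + 1) z.1 (n + 1) = z.1 (Fin.castSucc ⟨n, h⟩) := by
    simp [xc, show n < M + 1 by omega]
  have h2 : xc (M + 1) z.1 (n + 2) = z.1 (Fin.succ ⟨n, h⟩) := by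
    simp [xc, h]
  rw [h1, h2, al, be, dif_pos h, dif_pos h, ← Complex.exp_add, Complex.ofReal_exp]
  congr 1
  simp

theorem exp_xc_y {n : ℕ} (h : n + 1 < M) (z : (Fin (M + 1) → ℝ) × (Fin M → ℝ)) :
    ((Real.exp (xc M z.2 (n + 1) - xc M z.2 (n + 2)) : ℝ) : ℂ)
      = be (n + 1) z * al (n + 1) z := by
  have h1 : xc M z.2 (n + 1) = z.2 ⟨n, by omega⟩ := by
    simp [xc, show n < M by omega]
  have h2 : xc M z.2 (n + 2) = z.2 ⟨n + 1, h⟩ := by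
    simp [xc, h]
  rw [h1, h2, al, be, dif_pos h, dif_pos (by omega), ← Complex.exp_add, Complex.ofReal_exp]
  congr 1
  simp

variable {hbar : ℝ} {u v : ℂ}

/-- The kernel as a function of both sets of variables. -/
def kernel (M : ℕ) (hbar : ℝ) (v : ℂ) (z : (Fin (M + 1) → ℝ) × (Fin M → ℝ)) : ℂ :=
  Complex.exp (phase M hbar v z)

theorem isDecayKernel_kernel (hbar_pos : 0 < hbar) :
    IsDecayKernel (kernel M hbar v) (logDeriv M hbar v) :=
  isDecayKernel M hbar_pos v

theorem pOp_integral (hbar_pos : 0 < hbar) {P : (Fin (M + 1) → ℝ) × (Fin M → ℝ) → ℂ}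
    {g : (Fin M → ℝ) → ℂ} {m : ℕ∞} (hP : ExpGrowth ⊤ P) (hg : ExpGrowth m g) {n : ℕ}
    (hn : n < M + 1) (hinv : Invariant P (Pi.single ⟨n, hn⟩ 1, 0)) (x : Fin (M + 1) → ℝ) :
    (u * ∫ y, P (x, y) * kernel M hbar v (x, y) * g y)
      - pOp (M + 1) hbar (fun x => ∫ y, P (x, y) * kernel M hbar v (x, y) * g y) (n + 1) x
      = ∫ y, (u - v - Complex.I * al n (x, y) + Complex.I * be n (x, y)) * P (x, y)
          * kernel M hbar v (x, y) * g y := by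
  have hK := isDecayKernel_kernel (M := M) (v := v) hbar_pos
  have hb : (hbar : ℂ) ≠ 0 := by exact_mod_cast hbar_pos.ne'
  rw [pOp, dif_pos ⟨by omega, by simpa using hn⟩]
  simp only [Nat.add_sub_cancel]
  rw [hK.fderiv_integral_apply hP hg, ← integral_const_mul, ← integral_const_mul,
    ← integral_sub ((hK.integrable hP hg x).const_mul _)
      ((hK.integrable (hK.growth.twist hP _) hg x).const_mul _)]
  congr 1
  funext y
  rw [twist, hinv.fderiv_eq_zero (hP.differentiable _), logDeriv_x]
  field_simp
  linear_combination v * P (x, y) * kernel M hbar v (x, y) * g y * Complex.I_sq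

theorem integral_mul_pOp (hbar_pos : 0 < hbar) {P : (Fin (M + 1) → ℝ) × (Fin M → ℝ) → ℂ}
    {g : (Fin M → ℝ) → ℂ} {m : ℕ∞} (hP : ExpGrowth ⊤ P) (hm : 1 ≤ m) (hg : ExpGrowth m g) {n : ℕ}
    (hn : n < M) (hinv : Invariant P (0, Pi.single ⟨n, hn⟩ 1)) (x : Fin (M + 1) → ℝ) :
    ∫ y, P (x, y) * kernel M hbar v (x, y) * (u * g y - pOp M hbar g (n + 1) y)
      = ∫ y, (u - v - Complex.I * al n (x, y) + Complex.I * be (n + 1) (x, y)) * P (x, y)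
          * kernel M hbar v (x, y) * g y := by
  have hK := isDecayKernel_kernel (M := M) (v := v) hbar_pos
  have hb : (hbar : ℂ) ≠ 0 := by exact_mod_cast hbar_pos.ne'
  have h1 : ∀ y, P (x, y) * kernel M hbar v (x, y) * (u * g y - pOp M hbar g (n + 1) y)
      = u * (P (x, y) * kernel M hbar v (x, y) * g y) + Complex.I * hbar *
        (P (x, y) * kernel M hbar v (x, y) * fderiv ℝ g y (Pi.single ⟨n, hn⟩ 1)) := fun y => by
    rw [pOp, dif_pos ⟨by omega, by simpa using hn⟩]
    simp only [Nat.add_sub_cancel]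
    ring
  have hg' := (hg.fderiv (m := 0) (by simpa using hm)).clm_apply (Pi.single ⟨n, hn⟩ 1)
  simp only [h1]
  rw [integral_add ((hK.integrable hP hg x).const_mul _) ((hK.integrable hP hg' x).const_mul _),
    integral_const_mul, integral_const_mul, hK.integral_mul_fderiv hP hm hg, mul_neg,
    ← integral_const_mul, ← integral_const_mul, ← sub_eq_add_neg,
    ← integral_sub ((hK.integrable hP hg x).const_mul _)
      ((hK.integrable (hK.growth.twist hP _) hg x).const_mul _)]
  congr 1
  funext y
  rw [twist, hinv.fderiv_eq_zero (hP.differentiable _), logDeriv_y]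
  field_simp
  linear_combination v * P (x, y) * kernel M hbar v (x, y) * g y * Complex.I_sq

theorem aop_integral (hbar_pos : 0 < hbar) {g : (Fin M → ℝ) → ℂ} {m : ℕ∞} (hg : ExpGrowth m g) :
    ∀ n : ℕ, n ≤ M + 1 →
      Aop (M + 1) hbar u n (fun x => ∫ y, kernel M hbar v (x, y) * g y)
        = fun x => ∫ y, symX (u - v) (al · (x, y)) (be · (x, y)) n
          * kernel M hbar v (x, y) * g y
  | 0, _ => by
    funext x
    simp [Aop, symX]
  | 1, h => by
    funext x
    have := pOp_integral (u := u) (v := v) hbar_pos (ExpGrowth.const (1 : ℂ)) hg (n := 0) h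
      (fun _ _ => rfl) x
    simp only [one_mul, mul_one] at this
    simpa only [Aop, symX] using this
  | n + 2, h => by
    funext x
    have hK := isDecayKernel_kernel (M := M) (v := v) hbar_pos
    have h1 := pOp_integral (u := u) (v := v) hbar_pos (growth_symX (M := M) (u - v) (n + 1)) hg h
      (symX_invariant (u - v) ⟨n + 1, h⟩ (n + 1) le_rfl) x
    rw [Aop, aop_integral hbar_pos hg (n + 1) (by omega), aop_integral hbar_pos hg n (by omega)]
    beta_reduce
    rw [h1,
      ← integral_const_mul, ← integral_sub (hK.integrable
        ((growth_factor _ _ _).mul (growth_symX (u - v) (n + 1))) hg x)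
        ((hK.integrable (growth_symX (u - v) n) hg x).const_mul _)]
    congr 1
    funext y
    rw [exp_xc_x (by omega) (x, y), symX]
    ring

theorem growth_pOp {g : (Fin M → ℝ) → ℂ} {m n : ℕ} (hn : n < M) (hg : ExpGrowth (m + 1 : ℕ) g) :
    ExpGrowth m (pOp M hbar g (n + 1)) := by
  have : pOp M hbar g (n + 1)
      = fun y => -Complex.I * hbar * fderiv ℝ g y (Pi.single ⟨n, hn⟩ 1) := by
    funext y
    rw [pOp, dif_pos ⟨by omega, by simpa using hn⟩]
    rfl
  rw [this]
  exact (ExpGrowth.const _).mul ((hg.fderiv (by push_cast; rfl)).clm_apply _)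

theorem growth_exp_xc {m n : ℕ} (hn : n + 1 < M) : ExpGrowth m fun y : Fin M → ℝ =>
    ((Real.exp (xc M y (n + 1) - xc M y (n + 2)) : ℝ) : ℂ) := by
  have : (fun y : Fin M → ℝ => ((Real.exp (xc M y (n + 1) - xc M y (n + 2)) : ℝ) : ℂ))
      = fun y => Complex.exp (Complex.ofRealCLM.comp
        (ContinuousLinearMap.proj (R := ℝ) (φ := fun _ : Fin M => ℝ) ⟨n, by omega⟩
          - ContinuousLinearMap.proj (R := ℝ) (φ := fun _ : Fin M => ℝ) ⟨n + 1, hn⟩) y) := by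
    funext y
    simp [xc, show n < M by omega, hn]
  rw [this]
  exact ExpGrowth.cexp _

theorem growth_aop {f : (Fin M → ℝ) → ℂ} {k : ℕ} (hf : ExpGrowth k f) (n : ℕ) :
    ∀ m : ℕ, n ≤ M → m + n ≤ k → ExpGrowth m (Aop M hbar u n f) := by
  induction n using Nat.twoStepInduction with
  | zero => exact fun m _ h => hf.mono (by exact_mod_cast h)
  | one =>
    intro m hn h
    exact ((ExpGrowth.const u).mul (hf.mono (by exact_mod_cast (by omega : m ≤ k)))).sub
      (growth_pOp hn (hf.mono (by exact_mod_cast h)))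
  | more n ih ih' =>
    intro m hn h
    exact (((ExpGrowth.const u).mul (ih' m (by omega) (by omega))).sub
      (growth_pOp hn (ih' (m + 1) (by omega) (by omega)))).sub
        ((growth_exp_xc hn).mul (ih m (by omega) (by omega)))

theorem integral_mul_aop (hbar_pos : 0 < hbar) {f : (Fin M → ℝ) → ℂ} {k : ℕ}
    (hf : ExpGrowth k f) (hk : M ≤ k) (x : Fin (M + 1) → ℝ) (n : ℕ) :
    ∀ W : (Fin (M + 1) → ℝ) × (Fin M → ℝ) → ℂ, n ≤ M → ExpGrowth ⊤ W →
      (∀ j : Fin M, j < n → Invariant W (0, Pi.single j 1)) →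
      ∫ y, W (x, y) * kernel M hbar v (x, y) * Aop M hbar u n f y
        = ∫ y, W (x, y) * symY (u - v) (al · (x, y)) (be · (x, y)) n
          * kernel M hbar v (x, y) * f y := by
  have hK := isDecayKernel_kernel (M := M) (v := v) hbar_pos
  induction n using Nat.twoStepInduction with
  | zero => intro W _ _ _; simp [Aop, symY]
  | one =>
    intro W hn hW hinv
    have := integral_mul_pOp (u := u) (v := v) hbar_pos hW
      (by exact_mod_cast (by omega : 1 ≤ k)) hf hn (hinv ⟨0, hn⟩ (by simp)) x
    simp only [Aop, symY]
    rw [this]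
    congr 1
    funext y
    ring
  | more n ih ih' =>
    intro W hn hW hinv
    have hA1 : ExpGrowth (1 : ℕ) (Aop M hbar u (n + 1) f) :=
      growth_aop hf (n + 1) 1 (by omega) (by omega)
    have hA0 : ExpGrowth (0 : ℕ) (Aop M hbar u n f) := growth_aop hf n 0 (by omega) (by omega)
    have hA2 : ExpGrowth (0 : ℕ) fun y =>
        u * Aop M hbar u (n + 1) f y - pOp M hbar (Aop M hbar u (n + 1) f) (n + 2) y :=
      ((ExpGrowth.const u).mul (hA1.mono (by simp))).sub (growth_pOp hn hA1)
    have hE : ExpGrowth ⊤ fun z : (Fin (M + 1) → ℝ) × (Fin M → ℝ) =>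
        W z * (be (n + 1) z * al (n + 1) z) := hW.mul ((growth_be _).mul (growth_al _))
    have hW' : ExpGrowth ⊤ fun z : (Fin (M + 1) → ℝ) × (Fin M → ℝ) =>
        (u - v - Complex.I * al (n + 1) z + Complex.I * be (n + 2) z) * W z :=
      (growth_factor _ _ _).mul hW
    have h1 := integral_mul_pOp (u := u) (v := v) hbar_pos hW le_rfl hA1 hn
      (hinv ⟨n + 1, hn⟩ (by simp)) x
    have h2 := ih' _ (by omega) hW' fun j hj z t => by
      simp only [hinv j (by omega) z t, al_invariant_y (show n + 1 ≠ j.val by omega) z t,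
        be_invariant_y (show n + 2 ≠ j.val + 1 by omega) z t]
    have h3 := ih _ (by omega) hE fun j hj z t => by
      simp only [hinv j (by omega) z t, al_invariant_y (show n + 1 ≠ j.val by omega) z t,
        be_invariant_y (show n + 1 ≠ j.val + 1 by omega) z t]
    have h4 : ∀ y, W (x, y) * kernel M hbar v (x, y) * Aop M hbar u (n + 2) f y
        = W (x, y) * kernel M hbar v (x, y)
            * (u * Aop M hbar u (n + 1) f y - pOp M hbar (Aop M hbar u (n + 1) f) (n + 2) y)
          - W (x, y) * (be (n + 1) (x, y) * al (n + 1) (x, y)) * kernel M hbar v (x, y)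
            * Aop M hbar u n f y := fun y => by
      rw [Aop, exp_xc_y hn (x, y)]
      ring
    simp only [h4]
    rw [integral_sub (hK.integrable hW hA2 x) (hK.integrable hE hA0 x), h1, h2, h3,
      ← integral_sub (hK.integrable (hW'.mul (growth_symY (u - v) (n + 1))) hf x)
        (hK.integrable (hE.mul (growth_symY (u - v) n)) hf x)]
    congr 1
    funext y
    rw [symY]
    ring

theorem growth_of_bound {f : (Fin M → ℝ) → ℂ} (hf : ContDiff ℝ (⊤ : ℕ∞) f) {C a : ℝ} {N : ℕ}
    (hC : 0 < C) (ha : 0 < a) (hbound : ∀ m : ℕ, m ≤ N → ∀ y : Fin M → ℝ,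
      ‖iteratedFDeriv ℝ m f y‖ ≤ C * Real.exp (a * ∑ i, |y i|)) : ExpGrowth N f := by
  refine ⟨hf, fun k hk => ⟨C, a * M, hC.le, by positivity, fun y => ?_⟩⟩
  refine (hbound k (by exact_mod_cast hk) y).trans ?_
  rw [mul_assoc]
  gcongr
  refine (Finset.sum_le_sum fun i _ => norm_le_pi_norm y i).trans ?_
  simp

theorem intertwining (hbar_pos : 0 < hbar) {f : (Fin M → ℝ) → ℂ}
    (hf : ExpGrowth (M + 1 : ℕ) f) :
    (∀ x, Integrable fun y : Fin M → ℝ => Qker (M + 1) hbar v x y * f y) ∧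
    ContDiff ℝ (⊤ : ℕ∞) (fun x => ∫ y : Fin M → ℝ, Qker (M + 1) hbar v x y * f y) ∧
    ∀ x, Aop (M + 1) hbar u (M + 1) (fun x => ∫ y : Fin M → ℝ, Qker (M + 1) hbar v x y * f y) x
      = (u - v) * ∫ y : Fin M → ℝ, Qker (M + 1) hbar v x y * Aop M hbar u M f y := by
  have hK := isDecayKernel_kernel (M := M) (v := v) hbar_pos
  have hQ : ∀ x (y : Fin M → ℝ), Qker (M + 1) hbar v x y = kernel M hbar v (x, y) :=
    qker_eq M hbar v
  have h1 : ExpGrowth ⊤ fun _ : (Fin (M + 1) → ℝ) × (Fin M → ℝ) => (1 : ℂ) := ExpGrowth.const 1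
  simp only [hQ]
  refine ⟨fun x => by simpa using hK.integrable h1 hf x,
    by simpa using hK.contDiff_integral h1 hf, fun x => ?_⟩
  have h2 := integral_mul_aop (u := u) (v := v) hbar_pos hf (Nat.le_succ M) x M (fun _ => 1) le_rfl
    h1 fun _ _ _ _ => rfl
  simp only [one_mul] at h2
  rw [aop_integral hbar_pos hf _ le_rfl, h2, ← integral_const_mul]
  beta_reduce
  congr 1
  funext y
  rw [(symX_symY (u - v) (al · (x, y)) (be · (x, y)) rfl M).1]
  have : al M (x, y) = 0 := dif_neg (lt_irrefl M)
  rw [this]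
  ring

end Toda

/-- for smooth `f` of at most exponential growth together with its partial
derivatives of order `≤ N`, the transform `(𝒬_v f)(x) = ∫ Q^{(N)}_v(x;y) f(y) dy` is well
defined and smooth, and the intertwining relation
`A_N(u)(𝒬_v f) = (u − v) 𝒬_v(A_{N−1}(u) f)` holds. -/
theorem baxter_intertwining (N : ℕ) (hN : 2 ≤ N) (hbar : ℝ) (hhbar : 0 < hbar)
    (u v : ℂ) (f : (Fin (N - 1) → ℝ) → ℂ) (hf : ContDiff ℝ (⊤ : ℕ∞) f)
    (C a : ℝ) (hC : 0 < C) (ha : 0 < a)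
    (hbound : ∀ m : ℕ, m ≤ N → ∀ y : Fin (N - 1) → ℝ,
      ‖iteratedFDeriv ℝ m f y‖ ≤ C * Real.exp (a * ∑ i : Fin (N - 1), |y i|)) :
    (∀ x : Fin N → ℝ, Integrable fun y : Fin (N - 1) → ℝ => Qker N hbar v x y * f y) ∧
    ContDiff ℝ (⊤ : ℕ∞)
      (fun x : Fin N → ℝ => ∫ y : Fin (N - 1) → ℝ, Qker N hbar v x y * f y) ∧
    ∀ x : Fin N → ℝ,
      Aop N hbar u N (fun x' => ∫ y : Fin (N - 1) → ℝ, Qker N hbar v x' y * f y) x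
        = (u - v) *
            ∫ y : Fin (N - 1) → ℝ, Qker N hbar v x y * Aop (N - 1) hbar u (N - 1) f y := by
  obtain ⟨M, rfl⟩ : ∃ M, N = M + 1 := ⟨N - 1, by omega⟩
  exact Toda.intertwining (M := M) hhbar (Toda.growth_of_bound hf hC ha hbound)
end
end
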